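/- arXiv:1803.04367 — 2 statements merged into one kernel-verified Lean document; each statement's English description precedes it below -/
import Mathlib

section
/- Let D = A₁(ℂ) be the first Weyl algebra with its ℤ-grading. Every graded left D-module that is simple as a D-module is isomorphic, as a graded module and up to a twist, to exactly one of the modules: M₀ = D/D∂, M_∞ = D/Dt, or M_α = D/D(E − α) with α ∈ J*. In particular, each of these modules is a simple D-module, and no two of them are isomorphic even after twisting. -/
set_option synthInstance.maxHeartbeats 1000000
set_option maxHeartbeats 1000000

noncomputable section
open Polynomial

/-- The polynomial ring `ℂ[t]`. -/
abbrev PCc := Polynomial ℂ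

/-- Multiplication by `t` as a `ℂ`-linear endomorphism of `ℂ[t]`. -/
def tW : Module.End ℂ PCc := LinearMap.mulLeft ℂ (X : PCc)

/-- The derivative `∂ = d/dt` as a `ℂ`-linear endomorphism of `ℂ[t]`. -/
def dW : Module.End ℂ PCc := Polynomial.derivative

/-- The first Weyl algebra `A₁(ℂ)`: the ring of `ℂ`-linear differential operators on
`ℂ[t]`, i.e. the `ℂ`-subalgebra of endomorphisms of `ℂ[t]` generated by multiplication
by `t` and the derivative `∂`. -/
def Weyl : Subalgebra ℂ (Module.End ℂ PCc) := Algebra.adjoin ℂ {tW, dW}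

/-- The first Weyl algebra, as a type. -/
abbrev Wr : Type := ↥Weyl

noncomputable instance (priority := 5000) instWrRing : Ring Wr := inferInstance
noncomputable instance (priority := 5000) instWrSemiring : Semiring Wr := instWrRing.toSemiring

/-- `t` as an element of the Weyl algebra. -/
def tWe : Wr := ⟨tW, Algebra.subset_adjoin (by simp)⟩

/-- `∂` as an element of the Weyl algebra. -/
def dWe : Wr := ⟨dW, Algebra.subset_adjoin (by simp)⟩

/-- The Euler operator `E = t∂` as an element of the Weyl algebra. -/
def EWe : Wr := tWe * dWe

/-- An endomorphism of `ℂ[t]` is homogeneous of degree `w` if it maps the homogeneous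
component spanned by `t^i` into the one spanned by `t^(i+w)` for all `i` (where the
latter is `0` if `i + w < 0`); thus `t^n ∂^m` is homogeneous of degree `n - m`. -/
def WIsHomog (w : ℤ) (P : Module.End ℂ PCc) : Prop :=
  ∀ i : ℕ, ∃ c : ℂ,
    P (X ^ i) = c • (if 0 ≤ (i : ℤ) + w then (X : PCc) ^ ((i : ℤ) + w).toNat else 0)

/-- The homogeneous component of degree `w` of the Weyl algebra. -/
def Wgr (w : ℤ) : AddSubgroup Wr where
  carrier := {P | WIsHomog w (P : Module.End ℂ PCc)}
  zero_mem' := fun i => ⟨0, by simp⟩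
  add_mem' := by
    rintro P Q hP hQ i
    obtain ⟨c, hc⟩ := hP i
    obtain ⟨d, hd⟩ := hQ i
    exact ⟨c + d, by
      show ((P : Module.End ℂ PCc) + Q) (X ^ i) = _
      rw [LinearMap.add_apply, hc, hd, add_smul]⟩
  neg_mem' := by
    rintro P hP i
    obtain ⟨c, hc⟩ := hP i
    exact ⟨-c, by
      show (-(P : Module.End ℂ PCc)) (X ^ i) = _
      rw [LinearMap.neg_apply, hc, neg_smul]⟩

/-- `J* = {α ∈ ℂ : 0 ≤ Re α < 1, α ≠ 0}`. -/
def Jstar : Set ℂ := {α : ℂ | 0 ≤ α.re ∧ α.re < 1 ∧ α ≠ 0}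

/-- The quotient of the Weyl algebra by the left ideal generated by `P`,
as a left module. -/
abbrev WQuot (P : Wr) : Type := Wr ⧸ (Ideal.span {P} : Ideal Wr)

/-- The induced grading on a quotient of the Weyl algebra by a (homogeneous) left
ideal: the component of degree `w` is the image of the component of degree `w` of
the Weyl algebra. -/
def WQgr (P : Wr) (w : ℤ) : AddSubgroup (WQuot P) :=
  AddSubgroup.map (Ideal.span {P} : Ideal Wr).mkQ.toAddMonoidHom (Wgr w)

/-- Two graded modules are isomorphic up to a twist if there is a module isomorphism
`e : M ≃ N` and an integer `n` with `e(Mᵢ) = N_{n+i}` for all `i`, i.e. `M ≅ N[n]`. -/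
def WGrIsoTw (M N : Type) [AddCommGroup M] [Module Wr M] [AddCommGroup N] [Module Wr N]
    (ℳ : ℤ → AddSubgroup M) (𝒩 : ℤ → AddSubgroup N) : Prop :=
  ∃ (n : ℤ) (e : M ≃ₗ[Wr] N), ∀ i : ℤ, (fun x => e x) '' (ℳ i : Set M) = (𝒩 (n + i) : Set N)

/-- The left ideals cutting out the modules `M₀ = D/D∂`, `M_∞ = D/Dt` and
`M_α = D/D(E-α)`; the index `none` stands for `∞`. -/
def WIdl : Option ℂ → Ideal Wr
  | none => Ideal.span {tWe}
  | some α => if α = 0 then Ideal.span {dWe} else Ideal.span {EWe - algebraMap ℂ Wr α}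

/-- The family of modules `M₀ = D/D∂`, `M_∞ = D/Dt` and `M_α = D/D(E-α)`. -/
abbrev WM (o : Option ℂ) : Type := Wr ⧸ WIdl o

/-- The induced grading on `M₀`, `M_∞` and `M_α`. -/
def WMgr (o : Option ℂ) (w : ℤ) : AddSubgroup (WM o) :=
  AddSubgroup.map (WIdl o).mkQ.toAddMonoidHom (Wgr w)

/-- The index set `{∞, 0} ∪ J*` for the family of simple graded modules. -/
def WIdx : Set (Option ℂ) :=
  {o : Option ℂ | o = none ∨ o = some 0 ∨ ∃ α ∈ Jstar, o = some α}

/-! ### Commutation rules -/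

lemma Wcoe_mul (P Q : Wr) : ((P * Q : Wr) : Module.End ℂ PCc) = P * Q := rfl
lemma Wcoe_add (P Q : Wr) : ((P + Q : Wr) : Module.End ℂ PCc) = P + Q := rfl
lemma Wcoe_one : ((1 : Wr) : Module.End ℂ PCc) = 1 := rfl
lemma Wcoe_t (p : PCc) : (tWe : Module.End ℂ PCc) p = X * p := rfl
lemma Wcoe_d (p : PCc) : (dWe : Module.End ℂ PCc) p = derivative p := rfl

lemma dt_rel : dWe * tWe = tWe * dWe + 1 := by
  apply Subtype.ext
  rw [Wcoe_add, Wcoe_mul, Wcoe_mul, Wcoe_one]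
  refine LinearMap.ext fun p => ?_
  rw [LinearMap.add_apply, Module.End.mul_apply, Module.End.mul_apply, Module.End.one_apply,
    Wcoe_t, Wcoe_d, Wcoe_d, Wcoe_t, derivative_mul, derivative_X, one_mul, add_comm]

/-- scalars -/
abbrev cW (c : ℂ) : Wr := algebraMap ℂ Wr c

lemma cW_comm (c : ℂ) (P : Wr) : cW c * P = P * cW c := Algebra.commutes c P

lemma dt_E : dWe * tWe = EWe + 1 := dt_rel

lemma E_t : EWe * tWe = tWe * (EWe + cW 1) := by
  rw [EWe, mul_assoc, dt_rel, cW, map_one]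

lemma E_d : EWe * dWe = dWe * (EWe + cW (-1)) := by
  rw [cW, map_neg, map_one, mul_add, EWe, ← mul_assoc, dt_rel]; noncomm_ring

lemma E_tpow (n : ℕ) : EWe * tWe ^ n = tWe ^ n * (EWe + cW n) := by
  induction n with
  | zero => simp [cW]
  | succ n ih =>
    rw [pow_succ, ← mul_assoc, ih, mul_assoc, add_mul, E_t, cW_comm, ← mul_add, ← mul_assoc]
    simp only [cW, Nat.cast_succ, map_add, add_assoc, add_comm (algebraMap ℂ Wr 1)]

lemma E_dpow (n : ℕ) : EWe * dWe ^ n = dWe ^ n * (EWe + cW (-n)) := by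
  induction n with
  | zero => simp [cW]
  | succ n ih =>
    rw [pow_succ, ← mul_assoc, ih, mul_assoc, add_mul, E_d, cW_comm, ← mul_add, ← mul_assoc]
    simp only [cW, Nat.cast_succ, map_add, add_assoc, neg_add_rev]

lemma d_tpow (n : ℕ) : dWe * tWe ^ (n + 1) = tWe ^ n * (EWe + cW (n + 1)) := by
  rw [pow_succ', ← mul_assoc, dt_E, add_mul, E_tpow, one_mul]
  simp only [cW, map_add, map_one, mul_add, mul_one, add_assoc]

lemma t_dpow (n : ℕ) : tWe * dWe ^ (n + 1) = dWe ^ n * (EWe + cW (-n)) := by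
  rw [pow_succ', ← mul_assoc, ← E_dpow]; rfl

/-- The homogeneous generator of degree `w`. -/
def uW : ℤ → Wr
  | Int.ofNat n => tWe ^ n
  | Int.negSucc n => dWe ^ (n + 1)

lemma uW_nat (n : ℕ) : uW n = tWe ^ n := rfl

lemma uW_zero : uW 0 = 1 := by
  show tWe ^ 0 = 1
  exact pow_zero _

lemma uW_neg (n : ℕ) : uW (-n) = dWe ^ n := by
  cases n with
  | zero => simp [uW_zero]
  | succ n => rfl

lemma E_uW (w : ℤ) : EWe * uW w = uW w * (EWe + cW w) := by
  obtain ⟨n, rfl | rfl⟩ := Int.eq_nat_or_neg w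
  · rw [uW_nat, E_tpow]; simp
  · rw [uW_neg, E_dpow]; simp

lemma t_uW (w : ℤ) : ∃ q : ℂ[X], tWe * uW w = uW (w + 1) * aeval EWe q := by
  cases w with
  | ofNat n =>
    exact ⟨1, by rw [map_one, mul_one]; exact (pow_succ' _ _).symm⟩
  | negSucc n =>
    refine ⟨X + C (-n : ℂ), ?_⟩
    have : Int.negSucc n + 1 = -(n : ℤ) := by omega
    rw [this, uW_neg, map_add, aeval_X, aeval_C]
    exact t_dpow n

lemma d_uW (w : ℤ) : ∃ q : ℂ[X], dWe * uW w = uW (w - 1) * aeval EWe q := by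
  obtain ⟨n, rfl | rfl⟩ := Int.eq_nat_or_neg w
  · cases n with
    | zero =>
      refine ⟨1, ?_⟩
      rw [Nat.cast_zero, uW_zero, map_one, mul_one, mul_one]
      exact (pow_one _).symm
    | succ n =>
      refine ⟨X + C (n + 1 : ℂ), ?_⟩
      have : ((n + 1 : ℕ) : ℤ) - 1 = (n : ℤ) := by omega
      rw [this, uW_nat, uW_nat, map_add, aeval_X, aeval_C]
      exact d_tpow n
  · refine ⟨1, ?_⟩
    have : -(n : ℤ) - 1 = -((n + 1 : ℕ) : ℤ) := by omega
    rw [this, uW_neg, uW_neg, map_one, mul_one, pow_succ']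

/-- the sum map -/
def PhiW : (ℤ →₀ ℂ[X]) →+ Wr :=
  Finsupp.liftAddHom fun w => (AddMonoidHom.mulLeft (uW w)).comp (aeval EWe : ℂ[X] →ₐ[ℂ] Wr).toAddMonoidHom

lemma PhiW_single (w : ℤ) (q : ℂ[X]) : PhiW (Finsupp.single w q) = uW w * aeval EWe q := by
  simp [PhiW]

lemma PhiW_apply (p : ℤ →₀ ℂ[X]) : PhiW p = ∑ w ∈ p.support, uW w * aeval EWe (p w) := by
  rw [PhiW, Finsupp.liftAddHom_apply, Finsupp.sum]; rfl

lemma PhiW_mul_mem (A : Wr) (hA : ∀ w, ∃ (w' : ℤ) (q : ℂ[X]), A * uW w = uW w' * aeval EWe q) (p : ℤ →₀ ℂ[X]) :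
    A * PhiW p ∈ AddMonoidHom.range PhiW := by
  rw [PhiW_apply, Finset.mul_sum]
  refine AddSubgroup.sum_mem _ fun w _ => ?_
  obtain ⟨w', q, h⟩ := hA w
  exact ⟨Finsupp.single w' (q * p w), by rw [PhiW_single, map_mul, ← mul_assoc, ← mul_assoc, h]⟩

lemma PhiW_surj (P : Wr) : ∃ p, PhiW p = P := by
  suffices h : ∀ p, P * PhiW p ∈ AddMonoidHom.range PhiW by
    have := h (Finsupp.single 0 1)
    rwa [PhiW_single, uW_zero, map_one, mul_one, mul_one] at this
  obtain ⟨P, hP⟩ := P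
  change P ∈ Algebra.adjoin ℂ {tW, dW} at hP
  induction hP using Algebra.adjoin_induction with
  | mem x hx =>
    intro p
    rcases hx with rfl | rfl
    · exact PhiW_mul_mem tWe (fun w => ⟨_, t_uW w⟩) p
    · exact PhiW_mul_mem dWe (fun w => ⟨_, d_uW w⟩) p
  | algebraMap r =>
    intro p
    refine PhiW_mul_mem (cW r) (fun w => ⟨w, C r, ?_⟩) p
    rw [aeval_C]; exact cW_comm r (uW w)
  | add x y hx hy h1 h2 =>
    intro p
    have := AddSubgroup.add_mem _ (h1 p) (h2 p)
    rwa [← add_mul] at this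
  | mul x y hx hy h1 h2 =>
    intro p
    obtain ⟨q, hq⟩ := h2 p
    have := h1 q
    rw [hq, ← mul_assoc] at this
    exact this

/-! ### Homogeneity -/

lemma Wgr_iff (w : ℤ) (P : Wr) : P ∈ Wgr w ↔ WIsHomog w (P : Module.End ℂ PCc) := Iff.rfl

lemma Wgr_mul {v w : ℤ} {P Q : Wr} (hP : P ∈ Wgr v) (hQ : Q ∈ Wgr w) : P * Q ∈ Wgr (v + w) := by
  intro i
  obtain ⟨c, hc⟩ := hQ i
  show ∃ c : ℂ, (P : Module.End ℂ PCc) ((Q : Module.End ℂ PCc) (X ^ i)) = _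
  rw [hc]
  by_cases h : 0 ≤ (i : ℤ) + w
  · obtain ⟨j, hj⟩ := Int.eq_ofNat_of_zero_le h
    obtain ⟨d, hd⟩ := hP j
    refine ⟨c * d, ?_⟩
    rw [if_pos h, hj, map_smul, Int.toNat_natCast, hd, mul_smul, ← hj, add_assoc, add_comm w v]
  · exact ⟨0, by rw [if_neg h]; simp⟩

lemma Wgr_cW (c : ℂ) : cW c ∈ Wgr 0 := by
  intro i
  refine ⟨c, ?_⟩
  rw [add_zero, if_pos (Int.natCast_nonneg i), Int.toNat_natCast]
  rfl

lemma Wgr_t : tWe ∈ Wgr 1 := by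
  intro i
  refine ⟨1, ?_⟩
  rw [if_pos (by omega), one_smul, show ((i : ℤ) + 1).toNat = i + 1 by omega, pow_succ']
  rfl

lemma dW_pow (i : ℕ) : dW (X ^ i) = (i : ℂ) • (X : ℂ[X]) ^ (i - 1) := by
  show derivative (X ^ i) = _
  rw [derivative_X_pow, smul_eq_C_mul]

lemma Wgr_d : dWe ∈ Wgr (-1) := by
  intro i
  refine ⟨i, ?_⟩
  show dW (X ^ i) = _
  rw [dW_pow]
  cases i with
  | zero => simp
  | succ i =>
    rw [if_pos (by omega)]
    congr 2
    omega

lemma Wgr_E : EWe ∈ Wgr 0 := by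
  have := Wgr_mul Wgr_t Wgr_d
  exact this

lemma Wgr_one : (1 : Wr) ∈ Wgr 0 := by
  have := Wgr_cW 1
  rwa [cW, map_one] at this

lemma Wgr_mul0 {P Q : Wr} (hP : P ∈ Wgr 0) (hQ : Q ∈ Wgr 0) : P * Q ∈ Wgr 0 := by
  have := Wgr_mul hP hQ
  rwa [add_zero] at this

lemma Wgr_aeval (p : ℂ[X]) : aeval EWe p ∈ Wgr 0 := by
  induction p using Polynomial.induction_on' with
  | add p q hp hq => rw [map_add]; exact AddSubgroup.add_mem _ hp hq
  | monomial n a =>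
    rw [aeval_monomial]
    have h : EWe ^ n ∈ Wgr 0 := by
      induction n with
      | zero => rw [pow_zero]; exact Wgr_one
      | succ n ih => rw [pow_succ]; exact Wgr_mul0 ih Wgr_E
    exact Wgr_mul0 (Wgr_cW a) h

lemma Wgr_u (w : ℤ) : uW w ∈ Wgr w := by
  obtain ⟨n, rfl | rfl⟩ := Int.eq_nat_or_neg w
  · rw [uW_nat]
    induction n with
    | zero => rw [pow_zero]; exact Wgr_one
    | succ n ih => rw [pow_succ, Nat.cast_succ]; exact Wgr_mul ih Wgr_t
  · rw [uW_neg]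
    induction n with
    | zero => rw [pow_zero]; exact Wgr_one
    | succ n ih => rw [pow_succ, Nat.cast_succ, neg_add]; exact Wgr_mul ih Wgr_d

lemma Wgr_up (w : ℤ) (p : ℂ[X]) : uW w * aeval EWe p ∈ Wgr w := by
  have := Wgr_mul (Wgr_u w) (Wgr_aeval p)
  rwa [add_zero] at this

lemma Wgr_coeff {w : ℤ} {P : Wr} (hP : P ∈ Wgr w) (i j : ℕ) (h : (j : ℤ) ≠ i + w) :
    ((P : Module.End ℂ PCc) (X ^ i)).coeff j = 0 := by
  obtain ⟨c, hc⟩ := hP i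
  rw [hc]
  split_ifs with h'
  · rw [coeff_smul, coeff_X_pow, if_neg (by omega), smul_zero]
  · simp

lemma PhiW_coeff (p : ℤ →₀ ℂ[X]) (i j : ℕ) :
    ((PhiW p : Module.End ℂ PCc) (X ^ i)).coeff j =
      (((uW (j - i) * aeval EWe (p (j - i)) : Wr) : Module.End ℂ PCc) (X ^ i)).coeff j := by
  classical
  let F : Wr →+ ℂ :=
    { toFun := fun P => ((P : Module.End ℂ PCc) (X ^ i)).coeff j
      map_zero' := by simp
      map_add' := by intro P Q; simp }
  show F (PhiW p) = F (uW (j - i) * aeval EWe (p (j - i)))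
  rw [PhiW_apply, map_sum]
  apply Finset.sum_eq_single
  · intro w _ hw
    exact Wgr_coeff (Wgr_up w _) i j (by omega)
  · intro hw
    rw [Finsupp.notMem_support_iff.1 hw, map_zero, mul_zero, map_zero]

lemma Wgr_struct {w : ℤ} {P : Wr} (hP : P ∈ Wgr w) : ∃ p : ℂ[X], P = uW w * aeval EWe p := by
  obtain ⟨p, rfl⟩ := PhiW_surj P
  refine ⟨p w, ?_⟩
  apply Subtype.ext
  refine Polynomial.lhom_ext' fun i => LinearMap.ext_ring ?_
  show (PhiW p : Module.End ℂ PCc) (monomial i 1) = _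
  simp only [LinearMap.comp_apply, ← X_pow_eq_monomial]
  ext j
  by_cases h : (j : ℤ) = i + w
  · rw [PhiW_coeff, show (j : ℤ) - i = w by omega]
  · rw [Wgr_coeff hP i j h, Wgr_coeff (Wgr_up w _) i j h]

/-! ### General modules -/

section mods

variable {M : Type} [AddCommGroup M] [Module Wr M]

lemma cW_smul_inv {c : ℂ} (hc : c ≠ 0) (x : M) : cW c⁻¹ • (cW c • x) = x := by
  rw [← mul_smul, cW, cW, ← map_mul, inv_mul_cancel₀ hc, map_one, one_smul]

lemma cW_smul_comm (c : ℂ) (P : Wr) (x : M) : cW c • (P • x) = P • (cW c • x) := by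
  rw [← mul_smul, cW_comm, mul_smul]

lemma cW_zero_smul (x : M) : cW 0 • x = 0 := by
  rw [cW, map_zero, zero_smul]

lemma mem_of_cW_smul (N : Submodule Wr M) {c : ℂ} (hc : c ≠ 0) {x : M} (h : cW c • x ∈ N) :
    x ∈ N := by
  rw [← cW_smul_inv hc x]
  exact N.smul_mem _ h

lemma eigen_sep (N : Submodule Wr M) (b : ℂ) (s : Finset ℤ) :
    ∀ (x : ℤ → M), (∀ w ∈ s, EWe • x w = cW (b + w) • x w) → (∑ w ∈ s, x w) ∈ N →
      ∀ w ∈ s, x w ∈ N := by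
  classical
  induction s using Finset.induction_on with
  | empty => intro x _ _ w hw; simp at hw
  | insert a s ha ih =>
    intro x hx hs
    have hs' : ∀ w ∈ s, x w ∈ N := by
      intro w hw
      have h1 : (EWe - cW (b + a)) • (∑ w ∈ insert a s, x w) = ∑ w ∈ s, cW ((w : ℂ) - a) • x w := by
        rw [Finset.sum_insert ha, smul_add, sub_smul, hx a (Finset.mem_insert_self _ _), sub_self,
          zero_add, Finset.smul_sum]
        refine Finset.sum_congr rfl fun w hw => ?_
        rw [sub_smul, hx w (Finset.mem_insert_of_mem hw), ← sub_smul, cW, cW, cW, ← map_sub]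
        congr 2
        ring
      have h2 := ih (fun w => cW ((w : ℂ) - a) • x w) (by
        intro w hw
        rw [← cW_smul_comm, hx w (Finset.mem_insert_of_mem hw), cW_smul_comm])
        (by rw [← h1]; exact N.smul_mem _ hs) w hw
      refine mem_of_cW_smul N ?_ h2
      have : w ≠ a := fun h => ha (h ▸ hw)
      rw [sub_ne_zero]
      exact_mod_cast this
    intro w hw
    rcases Finset.mem_insert.1 hw with rfl | hw
    · rw [Finset.sum_insert ha] at hs
      exact (N.add_mem_iff_left (N.sum_mem hs')).1 hs
    · exact hs' w hw

lemma aeval_eigen {x : M} {b : ℂ} (h : EWe • x = cW b • x) (p : ℂ[X]) :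
    aeval EWe p • x = cW (p.eval b) • x := by
  induction p using Polynomial.induction_on' with
  | add p q hp hq => rw [map_add, add_smul, hp, hq, eval_add, cW, cW, cW, map_add, add_smul]
  | monomial n a =>
    rw [aeval_monomial, eval_monomial, mul_smul, cW, map_mul, mul_smul]
    congr 1
    induction n with
    | zero => simp
    | succ n ih =>
      rw [pow_succ, mul_smul, h, ← cW_smul_comm, ih, pow_succ', map_mul, mul_smul]

lemma uW_eigen {x : M} {b : ℂ} (h : EWe • x = cW b • x) (w : ℤ) :
    EWe • (uW w • x) = cW (b + w) • (uW w • x) := by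
  rw [← mul_smul, E_uW, mul_smul, add_smul, h, ← add_smul, cW, cW, ← map_add, cW_smul_comm]

lemma graded_comp (ℳ : ℤ → AddSubgroup M) [DirectSum.Decomposition ℳ]
    [SetLike.GradedSMul Wgr ℳ] {k i : ℤ} {m : M} (hm : m ∈ ℳ k) (Q : Wr) (hQ : Q • m ∈ ℳ i) :
    ∃ p : ℂ[X], Q • m = (uW (i - k) * aeval EWe p) • m := by
  obtain ⟨p, rfl⟩ := PhiW_surj Q
  refine ⟨p (i - k), ?_⟩
  have hmem : ∀ w, (uW w * aeval EWe (p w)) • m ∈ ℳ (w + k) := fun w =>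
    SetLike.GradedSMul.smul_mem (Wgr_up w (p w)) hm
  have h1 := DirectSum.decompose_of_mem_same ℳ hQ
  rw [← h1, PhiW_apply, Finset.sum_smul, DirectSum.decompose_sum, DirectSum.sum_apply,
    AddSubgroup.val_finsetSum]
  rw [Finset.sum_eq_single (i - k)]
  · have := hmem (i - k)
    rw [sub_add_cancel] at this
    rw [DirectSum.decompose_of_mem_same ℳ this]
  · intro w _ hw
    exact DirectSum.decompose_of_mem_ne ℳ (hmem w) (by omega)
  · intro hw
    rw [Finsupp.notMem_support_iff.1 hw]
    simp

end mods

/-! ### The standard modules -/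

/-- generator -/
def vM (o : Option ℂ) : WM o := (WIdl o).mkQ 1

lemma mkQ_eq (o : Option ℂ) (Q : Wr) : (WIdl o).mkQ Q = Q • vM o := by
  rw [vM, ← map_smul, smul_eq_mul, mul_one]

lemma smul_vM_eq_zero (o : Option ℂ) (Q : Wr) : Q • vM o = 0 ↔ Q ∈ WIdl o := by
  rw [← mkQ_eq, Submodule.mkQ_apply, Submodule.Quotient.mk_eq_zero]

lemma exists_smul_vM (o : Option ℂ) (x : WM o) : ∃ Q : Wr, x = Q • vM o := by
  obtain ⟨Q, hQ⟩ := (WIdl o).mkQ_surjective x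
  exact ⟨Q, by rw [← mkQ_eq, hQ]⟩

/-- eigenvalue of the generator -/
def bM : Option ℂ → ℂ
  | none => -1
  | some a => a

lemma WIdl_some {a : ℂ} (ha : a ≠ 0) : WIdl (some a) = Ideal.span {EWe - algebraMap ℂ Wr a} := by
  rw [WIdl, if_neg ha]

lemma WIdl_zero : WIdl (some 0) = Ideal.span {dWe} := by
  rw [WIdl, if_pos rfl]

lemma t_none : tWe • vM none = 0 := by
  rw [smul_vM_eq_zero]; exact Ideal.subset_span rfl

lemma d_zero : dWe • vM (some 0) = 0 := by
  rw [smul_vM_eq_zero, WIdl_zero]; exact Ideal.subset_span rfl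

lemma E_vM (o : Option ℂ) : EWe • vM o = cW (bM o) • vM o := by
  cases o with
  | none =>
    have h : dWe • (tWe • vM none) = 0 := by rw [t_none, smul_zero]
    rw [← mul_smul, dt_E, add_smul, one_smul] at h
    rw [bM, cW, map_neg, map_one, neg_smul, one_smul]
    exact eq_neg_of_add_eq_zero_left h
  | some a =>
    by_cases ha : a = 0
    · subst ha
      rw [bM, cW_zero_smul, EWe, mul_smul, d_zero, smul_zero]
    · rw [← sub_eq_zero, ← sub_smul, smul_vM_eq_zero, WIdl_some ha]
      exact Ideal.subset_span rfl

lemma WMgr_iff (o : Option ℂ) (w : ℤ) (x : WM o) : x ∈ WMgr o w ↔ ∃ Q ∈ Wgr w, x = Q • vM o := by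
  constructor
  · rintro ⟨Q, hQ, rfl⟩
    exact ⟨Q, hQ, mkQ_eq o Q⟩
  · rintro ⟨Q, hQ, rfl⟩
    exact ⟨Q, hQ, mkQ_eq o Q⟩

lemma WMgr_struct {o : Option ℂ} {w : ℤ} {x : WM o} (hx : x ∈ WMgr o w) :
    ∃ c : ℂ, x = cW c • (uW w • vM o) := by
  obtain ⟨Q, hQ, rfl⟩ := (WMgr_iff o w x).1 hx
  obtain ⟨p, rfl⟩ := Wgr_struct hQ
  exact ⟨p.eval (bM o), by rw [mul_smul, aeval_eigen (E_vM o), cW_smul_comm]⟩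

lemma WMgr_eigen {o : Option ℂ} {w : ℤ} {x : WM o} (hx : x ∈ WMgr o w) :
    EWe • x = cW (bM o + w) • x := by
  obtain ⟨c, rfl⟩ := WMgr_struct hx
  rw [← cW_smul_comm, uW_eigen (E_vM o), cW_smul_comm]

lemma WMgr_sum (o : Option ℂ) (x : WM o) :
    ∃ p : ℤ →₀ ℂ[X], x = ∑ w ∈ p.support, (uW w * aeval EWe (p w)) • vM o := by
  obtain ⟨Q, rfl⟩ := exists_smul_vM o x
  obtain ⟨p, rfl⟩ := PhiW_surj Q
  exact ⟨p, by rw [PhiW_apply, Finset.sum_smul]⟩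

lemma WMgr_up (o : Option ℂ) (w : ℤ) (p : ℂ[X]) : (uW w * aeval EWe p) • vM o ∈ WMgr o w :=
  (WMgr_iff o w _).2 ⟨_, Wgr_up w p, rfl⟩

lemma WMgr_gsmul (o : Option ℂ) : SetLike.GradedSMul Wgr (WMgr o) := by
  refine ⟨?_⟩
  intro i j P x hP hx
  obtain ⟨Q, hQ, rfl⟩ := (WMgr_iff o j x).1 hx
  exact (WMgr_iff o _ _).2 ⟨P * Q, Wgr_mul hP hQ, by rw [mul_smul]⟩

lemma WMgr_decomp (o : Option ℂ) : Nonempty (DirectSum.Decomposition (WMgr o)) := by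
  classical
  suffices h : DirectSum.IsInternal (WMgr o) from ⟨h.chooseDecomposition⟩
  constructor
  · rw [injective_iff_map_eq_zero]
    intro x hx
    have h1 : DirectSum.coeAddMonoidHom (WMgr o) x = ∑ w ∈ DFinsupp.support x, ((x w : WMgr o w) : WM o) := by
      rw [DirectSum.coeAddMonoidHom_eq_dfinsuppSum, DFinsupp.sum]
    rw [h1] at hx
    have h2 := eigen_sep (⊥ : Submodule Wr (WM o)) (bM o) (DFinsupp.support x)
      (fun w => ((x w : WMgr o w) : WM o)) (fun w _ => WMgr_eigen (x w).2)
      (by rw [hx]; exact Submodule.zero_mem _)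
    refine DFinsupp.ext fun w => ?_
    by_cases hw : w ∈ DFinsupp.support x
    · exact Subtype.ext ((Submodule.mem_bot Wr).1 (h2 w hw))
    · exact DFinsupp.notMem_support_iff.1 hw
  · intro x
    obtain ⟨p, rfl⟩ := WMgr_sum o x
    refine ⟨∑ w ∈ p.support, DirectSum.of (fun w => WMgr o w) w ⟨_, WMgr_up o w (p w)⟩, ?_⟩
    rw [map_sum]
    refine Finset.sum_congr rfl fun w _ => ?_
    rw [DirectSum.coeAddMonoidHom_of]

lemma aeval_X_pow_apply (p : ℂ[X]) (i : ℕ) :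
    ((aeval EWe p : Wr) : Module.End ℂ PCc) (X ^ i) = p.eval (i : ℂ) • (X : ℂ[X]) ^ i := by
  have hE : (EWe : Module.End ℂ PCc) (X ^ i) = (i : ℂ) • (X : ℂ[X]) ^ i := by
    rw [EWe, Wcoe_mul, Module.End.mul_apply, Wcoe_d, Wcoe_t, derivative_X_pow, ← smul_eq_C_mul,
      mul_smul_comm]
    cases i with
    | zero => simp
    | succ i => rw [pow_succ']; rfl
  have hc : ∀ (c : ℂ) (q : PCc), ((cW c : Wr) : Module.End ℂ PCc) q = c • q := fun _ _ => rfl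
  induction p using Polynomial.induction_on' with
  | add p q hp hq => rw [map_add, Wcoe_add, LinearMap.add_apply, hp, hq, eval_add, add_smul]
  | monomial n a =>
    rw [aeval_monomial, eval_monomial, mul_smul, Wcoe_mul, Module.End.mul_apply, hc]
    congr 1
    induction n with
    | zero => rw [pow_zero, pow_zero, one_smul]; rfl
    | succ n ih =>
      rw [pow_succ, Wcoe_mul, Module.End.mul_apply, hE, map_smul, ih, pow_succ', mul_smul]

lemma poly_contra (q : ℂ[X]) (a : ℂ) (h : ∀ i : ℕ, ((i : ℂ) + 1 - a) * q.eval ((i : ℂ) + 1) = 1) :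
    False := by
  have h1 : (X - C a) * q = 1 := by
    refine Polynomial.eq_of_infinite_eval_eq _ _ ?_
    refine Set.Infinite.mono (s := Set.range fun i : ℕ => (i : ℂ) + 1) ?_ ?_
    · rintro _ ⟨i, rfl⟩
      simpa using h i
    · apply Set.infinite_range_of_injective
      intro i j hij
      simpa using hij
  have := congrArg (eval a) h1
  simp at this

lemma vM_ne_zero (o : Option ℂ) : vM o ≠ 0 := by
  intro h0
  have h : (1 : Wr) ∈ WIdl o := by
    rw [← smul_vM_eq_zero, one_smul, h0]
  cases o with
  | none =>
    obtain ⟨Q, hQ⟩ := Ideal.mem_span_singleton'.1 h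
    obtain ⟨p, rfl⟩ := PhiW_surj Q
    refine poly_contra (p (-1)) 0 fun i => ?_
    have h1 := PhiW_coeff p (i + 1) i
    have h2 : ((PhiW p * tWe : Wr) : Module.End ℂ PCc) (X ^ i) = X ^ i := by rw [hQ]; rfl
    rw [Wcoe_mul, Module.End.mul_apply, Wcoe_t, ← pow_succ'] at h2
    rw [h2, show ((i : ℤ) - (i + 1 : ℕ)) = -1 by omega, Wcoe_mul, Module.End.mul_apply,
      aeval_X_pow_apply] at h1
    have h3 : uW (-1) = dWe := by
      have := uW_neg 1
      rwa [pow_one] at this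
    rw [h3, map_smul, Wcoe_d, derivative_X_pow, coeff_smul, coeff_C_mul, coeff_X_pow] at h1
    simp at h1
    rw [sub_zero, mul_comm]
    exact h1.symm
  | some a =>
    by_cases ha : a = 0
    · subst ha
      rw [WIdl_zero] at h
      obtain ⟨Q, hQ⟩ := Ideal.mem_span_singleton'.1 h
      have h2 : ((Q * dWe : Wr) : Module.End ℂ PCc) 1 = 1 := by rw [hQ]; rfl
      rw [Wcoe_mul, Module.End.mul_apply, Wcoe_d, derivative_one, map_zero] at h2
      exact zero_ne_one h2
    · rw [WIdl_some ha] at h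
      obtain ⟨Q, hQ⟩ := Ideal.mem_span_singleton'.1 h
      obtain ⟨p, rfl⟩ := PhiW_surj Q
      refine poly_contra (p 0) a fun i => ?_
      have h1 := PhiW_coeff p (i + 1) (i + 1)
      have h2 : ((PhiW p * (EWe - algebraMap ℂ Wr a) : Wr) : Module.End ℂ PCc) (X ^ (i + 1))
        = X ^ (i + 1) := by rw [hQ]; rfl
      have h4 : EWe - algebraMap ℂ Wr a = aeval EWe (X - C a) := by
        rw [map_sub, aeval_X, aeval_C]
      rw [h4, Wcoe_mul, Module.End.mul_apply, aeval_X_pow_apply, map_smul] at h2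
      rw [sub_self, uW_zero, one_mul, aeval_X_pow_apply] at h1
      have h5 := congrArg (fun q : ℂ[X] => q.coeff (i + 1)) h2
      simp only [coeff_smul, h1] at h5
      simpa using h5

/-! ### Simplicity -/

lemma bM_up {o : Option ℂ} (ho : o ∈ WIdx) : tWe • vM o = 0 ∨ ∀ n : ℕ, bM o + (n + 1) ≠ 0 := by
  rcases ho with rfl | rfl | ⟨a, ⟨h1, h2, h3⟩, rfl⟩
  · left; exact t_none
  · right
    intro n
    rw [bM, zero_add]
    exact_mod_cast n.succ_ne_zero
  · right
    intro n h
    have := congrArg Complex.re h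
    simp [bM] at this
    have : (0 : ℝ) ≤ n := n.cast_nonneg
    linarith

lemma bM_down {o : Option ℂ} (ho : o ∈ WIdx) : dWe • vM o = 0 ∨ ∀ n : ℕ, bM o + (-n) ≠ 0 := by
  rcases ho with rfl | rfl | ⟨a, ⟨h1, h2, h3⟩, rfl⟩
  · right
    intro n h
    have := congrArg Complex.re h
    simp [bM] at this
    have : (0 : ℝ) ≤ n := n.cast_nonneg
    linarith
  · left; exact d_zero
  · right
    intro n h
    have := congrArg Complex.re h
    simp [bM] at this
    have h4 : (n : ℝ) < 1 := by linarith
    have h5 : n = 0 := by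
      have : n < 1 := by exact_mod_cast h4
      omega
    subst h5
    simp [bM] at h
    exact h3 h

lemma vM_mem_of {o : Option ℂ} (ho : o ∈ WIdx) (N : Submodule Wr (WM o)) (w : ℤ)
    (h : uW w • vM o ∈ N) (h0 : uW w • vM o ≠ 0) : vM o ∈ N := by
  obtain ⟨n, rfl | rfl⟩ := Int.eq_nat_or_neg w
  · rw [uW_nat] at h h0
    rcases bM_up ho with ht | hb
    · cases n with
      | zero => rwa [pow_zero, one_smul] at h
      | succ n => rw [pow_succ, mul_smul, ht, smul_zero] at h0; exact absurd rfl h0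
    · clear h0
      induction n with
      | zero => rwa [pow_zero, one_smul] at h
      | succ n ih =>
        apply ih
        refine mem_of_cW_smul N (hb n) ?_
        have := N.smul_mem dWe h
        rwa [← mul_smul, d_tpow, mul_smul, add_smul, E_vM, ← add_smul, cW, cW, ← map_add,
          ← cW_smul_comm] at this
  · rw [uW_neg] at h h0
    rcases bM_down ho with ht | hb
    · cases n with
      | zero => rwa [pow_zero, one_smul] at h
      | succ n => rw [pow_succ, mul_smul, ht, smul_zero] at h0; exact absurd rfl h0
    · clear h0
      induction n with
      | zero => rwa [pow_zero, one_smul] at h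
      | succ n ih =>
        apply ih
        refine mem_of_cW_smul N (hb n) ?_
        have := N.smul_mem tWe h
        rwa [← mul_smul, t_dpow, mul_smul, add_smul, E_vM, ← add_smul, cW, cW, ← map_add,
          ← cW_smul_comm] at this

lemma WM_simple {o : Option ℂ} (ho : o ∈ WIdx) : IsSimpleModule Wr (WM o) := by
  have : Nontrivial (WM o) := ⟨⟨_, _, vM_ne_zero o⟩⟩
  rw [isSimpleModule_iff]
  refine { eq_bot_or_eq_top := fun N => ?_ }
  by_cases hN : N = ⊥
  · exact Or.inl hN
  right
  obtain ⟨x, hx, hx0⟩ := N.ne_bot_iff.1 hN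
  obtain ⟨p, rfl⟩ := WMgr_sum o x
  have h1 := eigen_sep N (bM o) _ _ (fun w _ => WMgr_eigen (WMgr_up o w (p w))) hx
  obtain ⟨w, hw, hw0⟩ := Finset.exists_ne_zero_of_sum_ne_zero hx0
  have h2 := h1 w hw
  obtain ⟨c, hc⟩ := WMgr_struct (WMgr_up o w (p w))
  rw [hc] at h2 hw0
  have hc0 : c ≠ 0 := by
    rintro rfl
    exact hw0 (cW_zero_smul _)
  have h3 := vM_mem_of ho N w (mem_of_cW_smul N hc0 h2) (fun h => hw0 (by rw [h, smul_zero]))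
  rw [eq_top_iff]
  rintro y -
  obtain ⟨Q, rfl⟩ := exists_smul_vM o y
  exact N.smul_mem _ h3

/-! ### Uniqueness -/

lemma J_uniq {a b : ℂ} (ha : 0 ≤ a.re ∧ a.re < 1) (hb : 0 ≤ b.re ∧ b.re < 1) {n : ℤ}
    (h : a = b + n) : a = b := by
  have := congrArg Complex.re h
  simp at this
  have h1 : (n : ℝ) < 1 := by linarith
  have h2 : (-1 : ℝ) < n := by linarith
  have h3 : n = 0 := by
    have h1 : n < 1 := by exact_mod_cast h1
    have h2 : -1 < n := by exact_mod_cast h2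
    omega
  rw [h, h3]; simp

lemma J_int {a : ℂ} (ha : a ∈ Jstar) (n : ℤ) : a ≠ n := by
  intro h
  refine ha.2.2 (J_uniq (b := 0) (n := n) ⟨ha.1, ha.2.1⟩ (by simp) ?_)
  rw [h, zero_add]

lemma WM_uniq {o o' : Option ℂ} (ho : o ∈ WIdx) (ho' : o' ∈ WIdx)
    (h : WGrIsoTw (WM o) (WM o') (WMgr o) (WMgr o')) : o = o' := by
  obtain ⟨n, e, he⟩ := h
  have hv : vM o ∈ WMgr o 0 := (WMgr_iff o 0 _).2 ⟨1, Wgr_one, by rw [one_smul]⟩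
  have hy : e (vM o) ∈ WMgr o' n := by
    have : e (vM o) ∈ (WMgr o' (n + 0) : Set (WM o')) := by
      rw [← he 0]; exact ⟨_, hv, rfl⟩
    rwa [add_zero] at this
  have hy0 : e (vM o) ≠ 0 := fun h => vM_ne_zero o (e.map_eq_zero_iff.1 h)
  obtain ⟨c, hc⟩ := WMgr_struct hy
  have hu : uW n • vM o' ≠ 0 := fun h => hy0 (by rw [hc, h, smul_zero])
  have hb : bM o = bM o' + n := by
    have h1 := WMgr_eigen hy
    rw [← map_smul, E_vM, map_smul] at h1
    by_contra hne
    have h2 : cW (bM o - (bM o' + n)) • e (vM o) = 0 := by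
      rw [cW, map_sub, sub_smul, h1, sub_self]
    have h3 := mem_of_cW_smul (⊥ : Submodule Wr (WM o')) (sub_ne_zero.2 hne)
      (by rw [h2]; exact Submodule.zero_mem _)
    exact hy0 ((Submodule.mem_bot Wr).1 h3)
  have key : ∀ a : ℂ, a ∈ Jstar → 0 ≤ a.re ∧ a.re < 1 := fun a ha => ⟨ha.1, ha.2.1⟩
  have key0 : 0 ≤ (0 : ℂ).re ∧ (0 : ℂ).re < 1 := by simp
  rcases ho with rfl | rfl | ⟨a, ha, rfl⟩ <;> rcases ho' with rfl | rfl | ⟨a', ha', rfl⟩ <;>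
    simp only [bM] at hb
  · rfl
  · exfalso
    have hn : n = -1 := by
      rw [zero_add] at hb; exact_mod_cast hb.symm
    subst hn
    apply hu
    have := uW_neg 1
    rw [pow_one] at this
    rw [show (-1 : ℤ) = -((1 : ℕ) : ℤ) by simp, this, d_zero]
  · exfalso
    refine J_int ha' (-1 - n) ?_
    push_cast
    rw [hb]; ring
  · exfalso
    have hn : n = 1 := by
      have : (n : ℂ) = 1 := by linear_combination -hb
      exact_mod_cast this
    subst hn
    apply hu
    have := uW_nat 1
    rw [pow_one] at this
    rw [show (1 : ℤ) = ((1 : ℕ) : ℤ) by simp, this, t_none]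
  · rfl
  · rw [J_uniq key0 (key _ ha') hb]
  · exfalso
    refine J_int ha (-1 + n) ?_
    push_cast
    exact hb
  · rw [J_uniq (key _ ha) key0 hb]
  · rw [J_uniq (key _ ha) (key _ ha') hb]

/-! ### Classification -/

section classif

variable {M : Type} [AddCommGroup M] [Module Wr M] (ℳ : ℤ → AddSubgroup M)
  [DirectSum.Decomposition ℳ] [SetLike.GradedSMul Wgr ℳ]

lemma iso_of {o : Option ℂ} (ho : o ∈ WIdx) [IsSimpleModule Wr M] {k : ℤ} {m : M}
    (hm : m ∈ ℳ k) (hm0 : m ≠ 0) (hI : WIdl o ≤ LinearMap.ker (LinearMap.toSpanSingleton Wr M m)) :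
    WGrIsoTw M (WM o) ℳ (WMgr o) := by
  have := WM_simple ho
  let f : WM o →ₗ[Wr] M := (WIdl o).liftQ (LinearMap.toSpanSingleton Wr M m) hI
  have hfv : ∀ Q : Wr, f (Q • vM o) = Q • m := by
    intro Q
    rw [← mkQ_eq, Submodule.mkQ_apply]
    exact Submodule.liftQ_apply _ _ _
  have hf0 : f ≠ 0 := by
    intro h
    apply hm0
    have := hfv 1
    rw [one_smul, one_smul, h] at this
    exact this.symm
  let e := LinearEquiv.ofBijective f (LinearMap.bijective_of_ne_zero hf0)
  have hef : ∀ x, e x = f x := fun _ => rfl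
  refine ⟨-k, e.symm, fun i => ?_⟩
  ext y
  constructor
  · rintro ⟨x, hx, rfl⟩
    obtain ⟨Q, hQ⟩ := exists_smul_vM o (e.symm x)
    have hxQ : x = Q • m := by
      rw [← hfv, ← hQ, ← hef, LinearEquiv.apply_symm_apply]
    subst hxQ
    obtain ⟨p, hp⟩ := graded_comp ℳ hm Q hx
    show e.symm (Q • m) ∈ WMgr o (-k + i)
    rw [hp, ← hfv, ← hef, LinearEquiv.symm_apply_apply, neg_add_eq_sub]
    exact WMgr_up o _ p
  · intro hy
    refine ⟨e y, ?_, e.symm_apply_apply y⟩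
    obtain ⟨Q, hQ, rfl⟩ := (WMgr_iff o _ y).1 hy
    rw [hef, hfv]
    have := SetLike.GradedSMul.smul_mem (A := Wgr) (B := ℳ) hQ hm
    rwa [vadd_eq_add, neg_add_eq_sub, sub_add_cancel] at this

lemma iso_t [IsSimpleModule Wr M] {k : ℤ} {m : M} (hm : m ∈ ℳ k) (hm0 : m ≠ 0)
    (h : tWe • m = 0) : ∃ o ∈ WIdx, WGrIsoTw M (WM o) ℳ (WMgr o) := by
  have ho : (none : Option ℂ) ∈ WIdx := Or.inl rfl
  refine ⟨none, ho, iso_of ℳ ho hm hm0 ?_⟩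
  rw [WIdl, Ideal.span_le, Set.singleton_subset_iff]
  exact h

lemma iso_d [IsSimpleModule Wr M] {k : ℤ} {m : M} (hm : m ∈ ℳ k) (hm0 : m ≠ 0)
    (h : dWe • m = 0) : ∃ o ∈ WIdx, WGrIsoTw M (WM o) ℳ (WMgr o) := by
  have ho : (some 0 : Option ℂ) ∈ WIdx := Or.inr (Or.inl rfl)
  refine ⟨some 0, ho, iso_of ℳ ho hm hm0 ?_⟩
  rw [WIdl_zero, Ideal.span_le, Set.singleton_subset_iff]
  exact h

lemma iso_E [IsSimpleModule Wr M] {k : ℤ} {m : M} (hm : m ∈ ℳ k) (hm0 : m ≠ 0) {a : ℂ}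
    (ha : a ∈ Jstar)
    (h : EWe • m = cW a • m) : ∃ o ∈ WIdx, WGrIsoTw M (WM o) ℳ (WMgr o) := by
  have ho : (some a : Option ℂ) ∈ WIdx := Or.inr (Or.inr ⟨a, ha, rfl⟩)
  refine ⟨some a, ho, iso_of ℳ ho hm hm0 ?_⟩
  rw [WIdl_some ha.2.2, Ideal.span_le, Set.singleton_subset_iff]
  show (EWe - algebraMap ℂ Wr a) • m = 0
  rw [sub_smul, h, sub_self]

lemma exists_eigen [IsSimpleModule Wr M] :
    ∃ (k : ℤ) (m : M) (a : ℂ), m ∈ ℳ k ∧ m ≠ 0 ∧ EWe • m = cW a • m := by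
  classical
  have : Nontrivial M := IsSimpleModule.nontrivial Wr M
  obtain ⟨x, hx⟩ := exists_ne (0 : M)
  obtain ⟨k, m, hm, hm0⟩ : ∃ (k : ℤ) (m : M), m ∈ ℳ k ∧ m ≠ 0 := by
    by_contra! hcon
    apply hx
    rw [← DirectSum.sum_support_decompose ℳ x]
    exact Finset.sum_eq_zero fun i _ => hcon i _ (SetLike.coe_mem _)
  have hEm : ∀ (q : ℂ[X]) (y : M), y ∈ ℳ k → aeval EWe q • y ∈ ℳ k := by
    intro q y hy
    have := SetLike.GradedSMul.smul_mem (A := Wgr) (B := ℳ) (Wgr_aeval q) hy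
    rwa [vadd_eq_add, zero_add] at this
  by_cases hE0 : EWe • m = 0
  · exact ⟨k, m, 0, hm, hm0, by rw [hE0, cW_zero_smul]⟩
  have hEmem : EWe • m ∈ ℳ k := by
    have := hEm X m hm
    rwa [aeval_X] at this
  obtain ⟨Q, hQ⟩ := (LinearMap.mem_range.1
    ((IsSimpleModule.toSpanSingleton_surjective Wr hE0) m))
  rw [LinearMap.toSpanSingleton_apply] at hQ
  obtain ⟨p, hp⟩ := graded_comp ℳ hEmem Q (by rw [hQ]; exact hm)
  rw [hQ, sub_self, uW_zero, one_mul] at hp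
  have hkill : aeval EWe (1 - p * X) • m = 0 := by
    rw [map_sub, map_one, map_mul, aeval_X, sub_smul, one_smul, mul_smul, ← hp, sub_self]
  have hne : (1 - p * X : ℂ[X]) ≠ 0 := by
    intro h
    have := congrArg (eval 0) h
    simp at this
  clear hp hQ hEmem hE0
  generalize (1 - p * X : ℂ[X]) = q at hkill hne
  obtain ⟨n, hn⟩ : ∃ n, q.natDegree = n := ⟨_, rfl⟩
  induction n generalizing q with
  | zero =>
    exfalso
    rw [eq_C_of_natDegree_eq_zero hn] at hkill hne
    rw [aeval_C] at hkill
    have hc : q.coeff 0 ≠ 0 := fun h => hne (by rw [h, C_0])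
    have := mem_of_cW_smul (⊥ : Submodule Wr M) hc (x := m) (by
      rw [Submodule.mem_bot]; exact hkill)
    exact hm0 ((Submodule.mem_bot Wr).1 this)
  | succ n ih =>
    obtain ⟨a, ha⟩ := IsAlgClosed.exists_root q (by
      rw [degree_eq_natDegree hne, hn]; exact_mod_cast n.succ_ne_zero)
    obtain ⟨r, rfl⟩ := dvd_iff_isRoot.2 ha
    have hr : r ≠ 0 := right_ne_zero_of_mul hne
    by_cases hr0 : aeval EWe r • m = 0
    · refine ih r hr0 hr ?_
      rw [natDegree_mul (X_sub_C_ne_zero a) hr, natDegree_X_sub_C] at hn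
      omega
    · refine ⟨k, aeval EWe r • m, a, hEm r m hm, hr0, ?_⟩
      rw [map_mul, mul_smul, map_sub, aeval_X, aeval_C, sub_smul, sub_eq_zero] at hkill
      exact hkill

lemma classify [IsSimpleModule Wr M] : ∃ o ∈ WIdx, WGrIsoTw M (WM o) ℳ (WMgr o) := by
  by_contra hcon
  have hT : ∀ (k : ℤ) (m : M), m ∈ ℳ k → m ≠ 0 → tWe • m ≠ 0 :=
    fun k m hm hm0 h => hcon (iso_t ℳ hm hm0 h)
  have hD : ∀ (k : ℤ) (m : M), m ∈ ℳ k → m ≠ 0 → dWe • m ≠ 0 :=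
    fun k m hm hm0 h => hcon (iso_d ℳ hm hm0 h)
  have hmem : ∀ (k : ℤ) (m : M) (w : ℤ) (P : Wr), P ∈ Wgr w → m ∈ ℳ k → P • m ∈ ℳ (w + k) :=
    fun k m w P hP hm => SetLike.GradedSMul.smul_mem (A := Wgr) (B := ℳ) hP hm
  have htn : ∀ (n : ℕ) (k : ℤ) (m : M), m ∈ ℳ k → m ≠ 0 → tWe ^ n • m ≠ 0 := by
    intro n
    induction n with
    | zero => intro k m _ h; rwa [pow_zero, one_smul]
    | succ n ih =>
      intro k m hm h
      rw [pow_succ, mul_smul]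
      exact ih _ _ (hmem _ _ _ _ Wgr_t hm) (hT k m hm h)
  have hdn : ∀ (n : ℕ) (k : ℤ) (m : M), m ∈ ℳ k → m ≠ 0 → dWe ^ n • m ≠ 0 := by
    intro n
    induction n with
    | zero => intro k m _ h; rwa [pow_zero, one_smul]
    | succ n ih =>
      intro k m hm h
      rw [pow_succ, mul_smul]
      exact ih _ _ (hmem _ _ _ _ Wgr_d hm) (hD k m hm h)
  obtain ⟨k, m, a, hm, hm0, hE⟩ := exists_eigen ℳ
  have hu : ∀ w : ℤ, uW w • m ≠ 0 := by
    intro w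
    obtain ⟨n, rfl | rfl⟩ := Int.eq_nat_or_neg w
    · rw [uW_nat]; exact htn n k m hm hm0
    · rw [uW_neg]; exact hdn n k m hm hm0
  have hE' := uW_eigen hE (-⌊a.re⌋)
  have hmm := hmem _ _ _ _ (Wgr_u (-⌊a.re⌋)) hm
  by_cases h0 : a + ((-⌊a.re⌋ : ℤ) : ℂ) = 0
  · rw [h0, cW_zero_smul, EWe, mul_smul] at hE'
    exact hT _ _ (hmem _ _ _ _ Wgr_d hmm) (hD _ _ hmm (hu _)) hE'
  · refine hcon (iso_E ℳ hmm (hu _) ⟨?_, ?_, h0⟩ hE')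
    · have := Int.floor_le a.re
      simp
      linarith
    · have := Int.lt_floor_add_one a.re
      simp
      linarith

end classif

/-- Every graded left module over the first Weyl algebra `D = A₁(ℂ)`
that is simple as a `D`-module is isomorphic, as a graded module and up to a twist, to
exactly one of `M₀ = D/D∂`, `M_∞ = D/Dt`, `M_α = D/D(E-α)` (`α ∈ J*`); in particular
each of these is a simple graded `D`-module, and no two of them are isomorphic even
after twisting. -/
theorem stmt_1 :
    (∀ o ∈ WIdx, IsSimpleModule Wr (WM o) ∧
      SetLike.GradedSMul Wgr (WMgr o) ∧ Nonempty (DirectSum.Decomposition (WMgr o))) ∧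
    (∀ (M : Type) [AddCommGroup M] [Module Wr M] (ℳ : ℤ → AddSubgroup M)
      [DirectSum.Decomposition ℳ] [SetLike.GradedSMul Wgr ℳ],
      IsSimpleModule Wr M → ∃ o ∈ WIdx, WGrIsoTw M (WM o) ℳ (WMgr o)) ∧
    (∀ o ∈ WIdx, ∀ o' ∈ WIdx, WGrIsoTw (WM o) (WM o') (WMgr o) (WMgr o') → o = o') := by
  refine ⟨fun o ho => ⟨WM_simple ho, WMgr_gsmul o, WMgr_decomp o⟩, ?_, ?_⟩
  · intro M _ _ ℳ _ _ hM
    exact classify ℳ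
  · intro o ho o' ho' h
    exact WM_uniq ho ho' h
end
end

section
/- Let R be a commutative ℕ-graded ℂ-algebra that is finitely generated as a ℂ-algebra with R₀ = ℂ, and let N ≠ 0 be a finitely generated ℕ-graded R-module (each graded piece N_n is then a finite-dimensional ℂ-vector space). Then there exist an integer m ≥ 1, a natural number d equal to the Krull dimension of the ring R/Ann_R(N), a positive integer e, and polynomials P₀, …, P_{m−1} ∈ ℚ[t], each of the form P_r(t) = (e/d!)·t^d + (terms of degree < d), such that for every r with 0 ≤ r < m and every sufficiently large integer n, the partial sum Σ_{i=0}^{nm+r} dim_ℂ N_i equals P_r(n). -/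
open Polynomial

/-- Eventually quasi-polynomial functions of period `m`. -/
def QPoly (m : ℕ) (f : ℕ → ℚ) : Prop :=
  ∀ r : ℕ, ∃ p : ℚ[X], ∃ n₀ : ℕ, ∀ n, n₀ ≤ n → p.eval (n : ℚ) = f (n * m + r)

lemma QPoly.add {m : ℕ} {f g : ℕ → ℚ} (hf : QPoly m f) (hg : QPoly m g) :
    QPoly m (fun n => f n + g n) := by
  intro r
  obtain ⟨p, a, hp⟩ := hf r
  obtain ⟨q, b, hq⟩ := hg r
  refine ⟨p + q, max a b, fun n hn => ?_⟩
  rw [eval_add, hp n (le_trans (le_max_left _ _) hn), hq n (le_trans (le_max_right _ _) hn)]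

lemma QPoly.sub {m : ℕ} {f g : ℕ → ℚ} (hf : QPoly m f) (hg : QPoly m g) :
    QPoly m (fun n => f n - g n) := by
  intro r
  obtain ⟨p, a, hp⟩ := hf r
  obtain ⟨q, b, hq⟩ := hg r
  refine ⟨p - q, max a b, fun n hn => ?_⟩
  rw [eval_sub, hp n (le_trans (le_max_left _ _) hn), hq n (le_trans (le_max_right _ _) hn)]

lemma QPoly.shift {m : ℕ} {f : ℕ → ℚ} (hf : QPoly m f) (s : ℕ) :
    QPoly m (fun n => f (n + s)) := by
  intro r
  obtain ⟨p, a, hp⟩ := hf (r + s)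
  exact ⟨p, a, fun n hn => by rw [hp n hn, ← add_assoc]⟩

lemma QPoly.of_eventually_zero {m : ℕ} (hm : 1 ≤ m) {f : ℕ → ℚ} (n₀ : ℕ)
    (h : ∀ n, n₀ ≤ n → f n = 0) : QPoly m f := by
  intro r
  refine ⟨0, n₀, fun n hn => ?_⟩
  rw [h _ (by nlinarith), eval_zero]

lemma QPoly.sum {m : ℕ} (hm : 1 ≤ m) {f : ℕ → ℕ → ℚ} (k : ℕ) (hf : ∀ i, QPoly m (f i)) :
    QPoly m (fun n => ∑ i ∈ Finset.range k, f i n) := by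
  induction k with
  | zero => exact QPoly.of_eventually_zero hm 0 (by simp)
  | succ k ih =>
    simp only [Finset.sum_range_succ]
    exact ih.add (hf k)

lemma exists_antidiff (p : ℚ[X]) : ∃ q : ℚ[X], ∀ x : ℚ, q.eval (x + 1) - q.eval x = p.eval x := by
  induction p using Polynomial.induction_on' with
  | add p q hp hq =>
    obtain ⟨a, ha⟩ := hp
    obtain ⟨b, hb⟩ := hq
    exact ⟨a + b, fun x => by simp only [eval_add]; linarith [ha x, hb x]⟩
  | monomial n a =>
    refine ⟨C (a / (n + 1)) * Polynomial.bernoulli (n + 1), fun x => ?_⟩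
    have := Polynomial.bernoulli_eval_one_add (n + 1) x
    simp only [eval_mul, eval_C, add_comm x 1, this, eval_monomial]
    have : (n : ℚ) + 1 ≠ 0 := by positivity
    push_cast
    try simp only [Nat.add_sub_cancel]
    field_simp
    ring

lemma QPoly.of_diff {m : ℕ} {f : ℕ → ℚ} (hf : QPoly m (fun n => f (n + m) - f n)) :
    QPoly m f := by
  intro r
  obtain ⟨p, a, hp⟩ := hf r
  obtain ⟨q, hq⟩ := exists_antidiff p
  refine ⟨q + C (f (a * m + r) - q.eval (a : ℚ)), a, fun n hn => ?_⟩
  induction n, hn using Nat.le_induction with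
  | base => simp
  | succ n hn ih =>
    have h1 := hp n hn
    have h2 := hq n
    simp only [eval_add, eval_C] at ih ⊢
    push_cast
    have : (n + 1) * m + r = n * m + r + m := by ring
    rw [this]
    linarith

lemma QPoly.of_diff_dvd {m s : ℕ} (hm : 1 ≤ m) (hs : s ∣ m) {f : ℕ → ℚ}
    (hf : QPoly m (fun n => f (n + s) - f n)) : QPoly m f := by
  obtain ⟨k, rfl⟩ := hs
  apply QPoly.of_diff
  have : (fun n => f (n + s * k) - f n) =
      fun n => ∑ i ∈ Finset.range k, (f (n + s * i + s) - f (n + s * i)) := by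
    funext n
    have := Finset.sum_range_sub (fun i => f (n + s * i)) k
    simp only [mul_zero, add_zero] at this
    rw [← this]
    refine Finset.sum_congr rfl fun i _ => ?_
    rw [mul_add, mul_one, add_assoc]
  rw [this]
  exact QPoly.sum hm k fun i => hf.shift (s * i)

lemma QPoly.partialSum {m : ℕ} (hm : 1 ≤ m) {f : ℕ → ℚ} (hf : QPoly m f) :
    QPoly m (fun n => ∑ i ∈ Finset.range (n + 1), f i) := by
  apply QPoly.of_diff_dvd hm (one_dvd m)
  have : (fun n => ∑ i ∈ Finset.range (n + 1 + 1), f i - ∑ i ∈ Finset.range (n + 1), f i)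
      = fun n => f (n + 1) := by
    funext n
    rw [Finset.sum_range_succ _ (n + 1)]
    ring
  rw [this]
  exact hf.shift 1

section asymptotics

open Filter Topology

lemma poly_degree_le_of_bound (p : ℚ[X]) (d : ℕ) (K : ℚ)
    (h : ∀ᶠ n : ℕ in atTop, |p.eval (n : ℚ)| ≤ K * (n : ℚ) ^ d) : p.degree ≤ d := by
  by_contra hlt
  push Not at hlt
  have h1 := Polynomial.abs_div_tendsto_atTop_atTop_of_degree_gt p (X ^ d) (by simpa using hlt)
    (by simp)
  have h2 := (h1.comp (tendsto_natCast_atTop_atTop (R := ℚ))).eventually (eventually_gt_atTop K)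
  obtain ⟨n, ⟨hn1, hn2⟩, hn3⟩ := ((h2.and h).and (eventually_gt_atTop 0)).exists
  simp only [Function.comp, eval_pow, eval_X] at hn1
  have hp : (0 : ℚ) < (n : ℚ) ^ d := by positivity
  rw [abs_div, abs_of_pos hp, lt_div_iff₀ hp] at hn1
  linarith

lemma poly_tendsto_coeff (p : ℚ[X]) (d : ℕ) (h : p.degree ≤ d) :
    Tendsto (fun n : ℕ => p.eval (n : ℚ) / (n : ℚ) ^ d) atTop (𝓝 (p.coeff d)) := by
  have key : Tendsto (fun x : ℚ => p.eval x / x ^ d) atTop (𝓝 (p.coeff d)) := by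
    rcases lt_or_eq_of_le h with h | h
    · rw [coeff_eq_zero_of_degree_lt h]
      simpa using Polynomial.div_tendsto_atTop_zero_of_degree_lt p (X ^ d) (by simpa using h)
    · have := Polynomial.div_tendsto_atTop_leadingCoeff_div_of_degree_eq p (X ^ d)
        (by simpa using h)
      have h' : p.natDegree = d := natDegree_eq_of_degree_eq_some h
      simpa [leadingCoeff, h'] using this
  exact key.comp tendsto_natCast_atTop_atTop

lemma poly_coeff_int (p : ℚ[X]) (d : ℕ) (h : p.degree ≤ d) (T : ℕ → ℕ) (n₀ : ℕ)
    (hT : ∀ n, n₀ ≤ n → p.eval (n : ℚ) = T n) : ∃ z : ℤ, p.coeff d * (d.factorial : ℚ) = z := by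
  have key : ((fwdDiff (1 : ℚ))^[d] (fun x => p.eval x)) (n₀ : ℚ) = p.coeff d * (d.factorial : ℚ) := by
    rcases lt_or_eq_of_le h with h | h
    · rw [coeff_eq_zero_of_degree_lt h]
      rcases eq_or_ne p 0 with rfl | hp
      · simp [fwdDiff_iter_eq_sum_shift]
      · rw [Polynomial.fwdDiff_iter_eq_zero_of_degree_lt ((natDegree_lt_iff_degree_lt hp).2 h)]
        simp
    · have h' : p.natDegree = d := natDegree_eq_of_degree_eq_some h
      have := Polynomial.fwdDiff_iter_degree_eq_factorial p
      rw [h'] at this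
      rw [this]
      simp [leadingCoeff, h']
  rw [← key, fwdDiff_iter_eq_sum_shift]
  refine ⟨∑ k ∈ Finset.range (d + 1), ((-1) ^ (d - k) * (d.choose k : ℤ)) * (T (n₀ + k) : ℤ), ?_⟩
  push_cast
  refine Finset.sum_congr rfl fun k _ => ?_
  have := hT (n₀ + k) (by omega)
  push_cast at this
  simp [this]

lemma final_numeric (T : ℕ → ℕ) (hmono : Monotone T) (m : ℕ) (hm : 1 ≤ m) (d : ℕ)
    (hQ : QPoly m (fun n => (T n : ℚ)))
    (hup : ∃ a b c : ℕ, ∀ n, T n ≤ a * (b * n + c + 1) ^ d)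
    (hlow : ∃ a c c' : ℕ, ∀ n, (n + 1) ^ d ≤ a * T (c * n + c')) :
    ∃ (e : ℕ), 0 < e ∧ ∃ P : Fin m → Polynomial ℚ,
      (∀ r : Fin m, (P r).degree ≤ d ∧ (P r).coeff d = (e : ℚ) / (Nat.factorial d : ℚ)) ∧
      (∀ r : Fin m, ∃ n₀ : ℕ, ∀ n : ℕ, n₀ ≤ n →
        (P r).eval (n : ℚ) = (T (n * m + (r : ℕ)) : ℚ)) := by
  choose P N hP using hQ
  replace hP : ∀ (r n : ℕ), N r ≤ n → eval (n : ℚ) (P r) = (T (n * m + r) : ℚ) := hP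
  have hdeg : ∀ r, (P r).degree ≤ d := by
    intro r
    obtain ⟨a, b, c, h⟩ := hup
    apply poly_degree_le_of_bound _ _ (a * (b * m + b * r + c + 1) ^ d)
    filter_upwards [eventually_ge_atTop (N r), eventually_ge_atTop 1] with n hn hn1
    rw [hP r n hn, abs_of_nonneg (by positivity), mul_assoc, ← mul_pow]
    calc (T (n * m + r) : ℚ) ≤ ((a * (b * (n * m + r) + c + 1) ^ d : ℕ) : ℚ) := by
          exact_mod_cast h _
      _ ≤ ((a * ((b * m + b * r + c + 1) * n) ^ d : ℕ) : ℚ) := by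
          norm_cast
          gcongr
          nlinarith [Nat.le_mul_of_pos_right (b * r) hn1, Nat.le_mul_of_pos_right c hn1]
      _ = _ := by push_cast; ring
  have hlim := fun r => poly_tendsto_coeff (P r) d (hdeg r)
  have hcoeff : ∀ r, r ≤ m → (P r).coeff d = (P 0).coeff d := by
    intro r hr
    apply le_antisymm
    · have h2 : Tendsto (fun n : ℕ => (P 0).eval ((n + 1 : ℕ) : ℚ) / ((n + 1 : ℕ) : ℚ) ^ d *
          (((n + 1 : ℕ) : ℚ) / (n : ℚ)) ^ d) atTop (𝓝 ((P 0).coeff d * 1 ^ d)) := by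
        refine ((hlim 0).comp (tendsto_add_atTop_nat 1)).mul (Tendsto.pow ?_ d)
        have h3 := (poly_tendsto_coeff (X + 1 : ℚ[X]) 1 (by compute_degree!))
        have : (X + 1 : ℚ[X]).coeff 1 = 1 := by simp [coeff_one]
        rw [this] at h3
        simpa using h3
      rw [one_pow, mul_one] at h2
      refine le_of_tendsto_of_tendsto (hlim r) h2 ?_
      filter_upwards [eventually_ge_atTop (N r), eventually_ge_atTop (N 0), eventually_ge_atTop 1]
        with n h1 h2 h3
      rw [hP r n h1, hP 0 (n + 1) (by omega), div_pow, div_mul_div_cancel₀ (by positivity)]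
      gcongr
      apply hmono
      nlinarith
    · refine le_of_tendsto_of_tendsto (hlim 0) (hlim r) ?_
      filter_upwards [eventually_ge_atTop (N r), eventually_ge_atTop (N 0)]
        with n h1 h2
      rw [hP r n h1, hP 0 n h2]
      gcongr
      apply hmono
      omega
  have hpos : 0 < (P 0).coeff d := by
    obtain ⟨a, c, c', h⟩ := hlow
    have hsub : Tendsto (fun n : ℕ => (c + 1) * n + c') atTop atTop := by
      apply tendsto_atTop_mono (f := fun n => n) _ tendsto_id
      intro n
      nlinarith
    have h1 := (hlim 0).comp hsub
    have ha : 0 < a := by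
      rcases Nat.eq_zero_or_pos a with rfl | ha
      · have := h 0
        simp at this
      · exact ha
    have h2 : (1 : ℚ) / (a * (c + 1 + c') ^ d) ≤ (P 0).coeff d := by
      refine ge_of_tendsto h1 ?_
      filter_upwards [eventually_ge_atTop (N 0), eventually_ge_atTop 1] with n hn hn1
      simp only [Function.comp]
      rw [hP 0 _ (by nlinarith), div_le_div_iff₀ (by positivity) (by positivity), one_mul]
      norm_cast
      have e1 : T (c * n + c') ≤ T (((c + 1) * n + c') * m + 0) := by
        apply hmono
        calc c * n + c' ≤ ((c + 1) * n + c') * 1 := by nlinarith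
          _ ≤ ((c + 1) * n + c') * m := by gcongr
      calc ((c + 1) * n + c') ^ d ≤ ((c + 1 + c') * (n + 1)) ^ d := by gcongr; nlinarith
        _ = (n + 1) ^ d * (c + 1 + c') ^ d := by rw [mul_pow, mul_comm]
        _ ≤ (a * T (c * n + c')) * (c + 1 + c') ^ d := by gcongr; exact h n
        _ ≤ (a * T (((c + 1) * n + c') * m + 0)) * (c + 1 + c') ^ d := by gcongr
        _ = _ := by ring
    refine lt_of_lt_of_le ?_ h2
    positivity
  obtain ⟨z, hz⟩ := poly_coeff_int (P 0) d (hdeg 0) (fun n => T (n * m + 0)) (N 0)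
    (fun n hn => hP 0 n hn)
  have hz0 : 0 < z := by
    have : (0 : ℚ) < z := by rw [← hz]; positivity
    exact_mod_cast this
  obtain ⟨e, rfl⟩ := Int.eq_ofNat_of_zero_le hz0.le
  refine ⟨e, by exact_mod_cast hz0, fun r => P r, fun r => ⟨hdeg r, ?_⟩, fun r => ⟨N r, hP r⟩⟩
  rw [hcoeff r r.2.le, eq_div_iff (by positivity), hz]
  simp

end asymptotics

lemma finrank_ker_domRestrict {V : Type} [AddCommGroup V] [Module ℂ V] (g : V →ₗ[ℂ] V)
    (A : Submodule ℂ V) : Module.finrank ℂ (LinearMap.ker (g.domRestrict A)) =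
      Module.finrank ℂ (A ⊓ LinearMap.ker g : Submodule ℂ V) := by
  rw [← Submodule.finrank_map_subtype_eq]
  suffices h : Submodule.map A.subtype (LinearMap.ker (g.domRestrict A)) = A ⊓ LinearMap.ker g by
    rw [h]
  ext v
  simp only [Submodule.mem_map, LinearMap.mem_ker, Submodule.mem_inf]
  constructor
  · rintro ⟨y, hy, rfl⟩
    exact ⟨y.2, hy⟩
  · rintro ⟨h1, h2⟩
    exact ⟨⟨v, h1⟩, h2, rfl⟩

lemma finrank_exact {V : Type} [AddCommGroup V] [Module ℂ V] (g : V →ₗ[ℂ] V) (A B : Submodule ℂ V)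
    [FiniteDimensional ℂ A] [FiniteDimensional ℂ B] :
    Module.finrank ℂ A + Module.finrank ℂ B =
      Module.finrank ℂ (A ⊓ B.comap g : Submodule ℂ V) +
      Module.finrank ℂ (B ⊔ A.map g : Submodule ℂ V) := by
  have h1 := Submodule.finrank_sup_add_finrank_inf_eq B (A.map g)
  have h2 := (g.domRestrict A).finrank_range_add_finrank_ker
  have h3 := (g.domRestrict (A ⊓ B.comap g)).finrank_range_add_finrank_ker
  rw [LinearMap.range_domRestrict, finrank_ker_domRestrict] at h2 h3
  have h4 : (A ⊓ B.comap g).map g = B ⊓ A.map g := by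
    rw [inf_comm B, Submodule.map_inf_eq_map_inf_comap]
  have h5 : A ⊓ B.comap g ⊓ LinearMap.ker g = A ⊓ LinearMap.ker g := by
    rw [inf_assoc]
    congr 1
    apply inf_eq_right.2
    intro v hv
    rw [Submodule.mem_comap, LinearMap.mem_ker.1 hv]
    exact zero_mem _
  rw [h4, h5] at h3
  omega

section graded

variable {R : Type} [CommRing R] [Algebra ℂ R] (𝒜 : ℕ → Submodule ℂ R)
    {N : Type} [AddCommGroup N] [Module ℂ N] [Module R N] [IsScalarTower ℂ R N]
    (ℳ : ℕ → Submodule ℂ N) [DirectSum.Decomposition ℳ]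

/-- Projection to the `i`-th graded piece. -/
def gpr (i : ℕ) : N →ₗ[ℂ] N :=
  (ℳ i).subtype ∘ₗ (DirectSum.component ℂ ℕ (fun i => ℳ i) i) ∘ₗ
    (DirectSum.decomposeLinearEquiv ℳ).toLinearMap

lemma gpr_apply (i : ℕ) (v : N) : gpr ℳ i v = (DirectSum.decompose ℳ v i : N) := rfl

lemma gpr_mem (i : ℕ) (v : N) : gpr ℳ i v ∈ ℳ i := by
  rw [gpr_apply]; exact Submodule.coe_mem _

lemma gpr_same {i : ℕ} {v : N} (h : v ∈ ℳ i) : gpr ℳ i v = v := by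
  rw [gpr_apply, DirectSum.decompose_of_mem_same ℳ h]

lemma gpr_ne {i j : ℕ} {v : N} (h : v ∈ ℳ i) (hij : i ≠ j) : gpr ℳ j v = 0 := by
  rw [gpr_apply, DirectSum.decompose_of_mem_ne ℳ h hij]

lemma eq_zero_of_gpr {v : N} (h : ∀ i, gpr ℳ i v = 0) : v = 0 := by
  classical
  rw [← DirectSum.sum_support_decompose ℳ v]
  exact Finset.sum_eq_zero fun i _ => h i

lemma exists_gpr_bound (v : N) : ∃ k, ∀ i, k ≤ i → gpr ℳ i v = 0 := by
  classical
  obtain ⟨k, hk⟩ := (DirectSum.decompose ℳ v).support.exists_nat_subset_range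
  refine ⟨k, fun i hi => ?_⟩
  by_contra hne
  have : i ∈ (DirectSum.decompose ℳ v).support := by
    rw [DFinsupp.mem_support_iff]
    intro h0
    apply hne
    rw [gpr_apply, h0]; rfl
  have := Finset.mem_range.1 (hk this)
  omega

lemma sum_gpr (v : N) (k : ℕ) (hk : ∀ i, k ≤ i → gpr ℳ i v = 0) :
    ∑ i ∈ Finset.range k, gpr ℳ i v = v := by
  rw [← sub_eq_zero]
  apply eq_zero_of_gpr ℳ
  intro j
  rw [map_sub, map_sum, sub_eq_zero]
  by_cases hj : j < k
  · rw [Finset.sum_eq_single j, gpr_same ℳ (gpr_mem ℳ j v)]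
    · intro b _ hb; exact gpr_ne ℳ (gpr_mem ℳ b v) hb
    · intro h; exact absurd (Finset.mem_range.2 hj) h
  · rw [hk j (by omega)]
    exact Finset.sum_eq_zero fun b hb => gpr_ne ℳ (gpr_mem ℳ b v)
      (by have := Finset.mem_range.1 hb; omega)

set_option linter.unusedSectionVars false

variable [SetLike.GradedSMul 𝒜 ℳ]

lemma gr_smul_mem {δ i : ℕ} {x : R} (hx : x ∈ 𝒜 δ) {v : N} (hv : v ∈ ℳ i) : x • v ∈ ℳ (i + δ) := by
  have := SetLike.GradedSMul.smul_mem (A := 𝒜) (B := ℳ) hx hv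
  rwa [vadd_eq_add, add_comm] at this

lemma gpr_smul {δ : ℕ} {x : R} (hx : x ∈ 𝒜 δ) (i : ℕ) (v : N) :
    gpr ℳ (i + δ) (x • v) = x • gpr ℳ i v := by
  induction v using DirectSum.Decomposition.inductionOn ℳ with
  | zero => simp
  | @homogeneous j m =>
    have hm := gr_smul_mem 𝒜 ℳ hx m.2
    by_cases h : j = i
    · subst h
      rw [gpr_same ℳ hm, gpr_same ℳ m.2]
    · rw [gpr_ne ℳ hm (by omega), gpr_ne ℳ m.2 h, smul_zero]
  | add a b ha hb => rw [smul_add, map_add, map_add, smul_add, ha, hb]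

lemma gpr_smul_lt {δ : ℕ} {x : R} (hx : x ∈ 𝒜 δ) (i : ℕ) (hi : i < δ) (v : N) :
    gpr ℳ i (x • v) = 0 := by
  induction v using DirectSum.Decomposition.inductionOn ℳ with
  | zero => simp
  | @homogeneous j m =>
    exact gpr_ne ℳ (gr_smul_mem 𝒜 ℳ hx m.2) (by omega)
  | add a b ha hb => rw [smul_add, map_add, ha, hb, add_zero]

/-- homogeneous submodules -/
def HomogSub (M : Submodule R N) : Prop := ∀ v ∈ M, ∀ i, gpr ℳ i v ∈ M

/-- the `n`-th piece of a submodule -/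
def piece (M : Submodule R N) (n : ℕ) : Submodule ℂ N := M.restrictScalars ℂ ⊓ ℳ n


/-- multiplication by `x`, as an `R`-linear map -/
def mulBy (x : R) : N →ₗ[R] N := LinearMap.lsmul R N x

lemma piece_inf (x : R) {δ : ℕ} (hx : x ∈ 𝒜 δ) (M₁ M₂ : Submodule R N) (n : ℕ) :
    piece ℳ (M₁ ⊓ M₂.comap (mulBy x)) n =
      piece ℳ M₁ n ⊓ (piece ℳ M₂ (n + δ)).comap ((mulBy (N := N) x).restrictScalars ℂ) := by
  ext v
  simp only [piece, Submodule.mem_inf, Submodule.restrictScalars_mem, Submodule.mem_comap,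
    LinearMap.coe_restrictScalars, mulBy, LinearMap.lsmul_apply]
  constructor
  · rintro ⟨⟨h1, h2⟩, h3⟩
    exact ⟨⟨h1, h3⟩, h2, gr_smul_mem 𝒜 ℳ hx h3⟩
  · rintro ⟨⟨h1, h3⟩, h2, _⟩
    exact ⟨⟨h1, h2⟩, h3⟩

lemma piece_sup (x : R) {δ : ℕ} (hx : x ∈ 𝒜 δ) (M₁ M₂ : Submodule R N) (h1 : HomogSub ℳ M₁)
    (h2 : HomogSub ℳ M₂) (n : ℕ) :
    piece ℳ (M₂ ⊔ M₁.map (mulBy x)) (n + δ) =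
      piece ℳ M₂ (n + δ) ⊔ (piece ℳ M₁ n).map ((mulBy (N := N) x).restrictScalars ℂ) := by
  apply le_antisymm
  · rintro v ⟨hv, hvn⟩
    obtain ⟨a, ha, b, hb, hab⟩ := Submodule.mem_sup.1 hv
    obtain ⟨w, hw, rfl⟩ := hb
    have : v = gpr ℳ (n + δ) a + x • gpr ℳ n w := by
      rw [← gpr_smul 𝒜 ℳ hx, ← gpr_same ℳ hvn, ← hab, map_add]
      rfl
    rw [this]
    refine add_mem (Submodule.mem_sup_left ⟨h2 a ha _, gpr_mem ℳ _ _⟩)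
      (Submodule.mem_sup_right ⟨gpr ℳ n w, ⟨h1 w hw _, gpr_mem ℳ _ _⟩, rfl⟩)
  · apply sup_le
    · rintro v ⟨hv, hvn⟩
      exact ⟨Submodule.mem_sup_left hv, hvn⟩
    · rintro _ ⟨w, ⟨hw, hwn⟩, rfl⟩
      exact ⟨Submodule.mem_sup_right ⟨w, hw, rfl⟩, gr_smul_mem 𝒜 ℳ hx hwn⟩

lemma homog_inf (x : R) {δ : ℕ} (hx : x ∈ 𝒜 δ) (M₁ M₂ : Submodule R N) (h1 : HomogSub ℳ M₁)
    (h2 : HomogSub ℳ M₂) : HomogSub ℳ (M₁ ⊓ M₂.comap (mulBy x)) := by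
  rintro v ⟨hv1, hv2⟩ i
  refine ⟨h1 v hv1 i, ?_⟩
  change x • gpr ℳ i v ∈ M₂
  rw [← gpr_smul 𝒜 ℳ hx]
  exact h2 _ hv2 _

lemma homog_sup (x : R) {δ : ℕ} (hx : x ∈ 𝒜 δ) (M₁ M₂ : Submodule R N) (h1 : HomogSub ℳ M₁)
    (h2 : HomogSub ℳ M₂) : HomogSub ℳ (M₂ ⊔ M₁.map (mulBy x)) := by
  intro v hv i
  obtain ⟨a, ha, b, hb, rfl⟩ := Submodule.mem_sup.1 hv
  obtain ⟨w, hw, rfl⟩ := hb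
  rw [map_add]
  refine add_mem (Submodule.mem_sup_left (h2 a ha _)) ?_
  change gpr ℳ i (x • w) ∈ _
  by_cases hi : i < δ
  · rw [gpr_smul_lt 𝒜 ℳ hx i hi]
    exact zero_mem _
  · obtain ⟨j, rfl⟩ := Nat.exists_eq_add_of_le (not_lt.1 hi)
    rw [add_comm, gpr_smul 𝒜 ℳ hx]
    exact Submodule.mem_sup_right ⟨_, h1 w hw j, rfl⟩

lemma qpoly_base [IsNoetherian R N] (s : Set R) (hs : Algebra.adjoin ℂ s = ⊤)
    (M₁ M₂ : Submodule R N) (h2 : HomogSub ℳ M₂)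
    (hk : ∀ x ∈ s, ∀ v ∈ M₁, x • v ∈ M₂) :
    ∃ n₀, ∀ n, n₀ ≤ n → ∀ v ∈ M₁, gpr ℳ n v ∈ M₂ := by
  have key : ∀ r : R, ∃ c : ℂ, ∀ v ∈ M₁, r • v - c • v ∈ M₂ := by
    intro r
    have hr : r ∈ Algebra.adjoin ℂ s := by rw [hs]; trivial
    induction hr using Algebra.adjoin_induction with
    | mem x hx => exact ⟨0, fun v hv => by simpa using hk x hx v hv⟩
    | algebraMap c => exact ⟨c, fun v hv => by simp⟩
    | add a b _ _ ha hb =>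
      obtain ⟨c, hc⟩ := ha
      obtain ⟨c', hc'⟩ := hb
      refine ⟨c + c', fun v hv => ?_⟩
      have := add_mem (hc v hv) (hc' v hv)
      rw [add_smul, add_smul]
      convert this using 1
      abel
    | mul a b _ _ ha hb =>
      obtain ⟨c, hc⟩ := ha
      obtain ⟨c', hc'⟩ := hb
      refine ⟨c * c', fun v hv => ?_⟩
      have e1 := M₂.smul_mem a (hc' v hv)
      have e2 : c' • (a • v - c • v) ∈ M₂ := by
        rw [← algebraMap_smul R c']
        exact M₂.smul_mem _ (hc v hv)
      have := add_mem e1 e2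
      convert this using 1
      rw [smul_sub, smul_sub, mul_smul, smul_comm a c', mul_comm c, mul_smul]
      abel
  obtain ⟨t, ht⟩ := IsNoetherian.noetherian M₁
  choose k hk using exists_gpr_bound ℳ
  refine ⟨t.sup k, fun n hn v hv => ?_⟩
  rw [← ht] at hv
  have aux : v ∈ M₁ ∧ gpr ℳ n v ∈ M₂ := by
    induction hv using Submodule.span_induction with
    | mem x hx =>
      refine ⟨by rw [← ht]; exact Submodule.subset_span hx, ?_⟩
      rw [hk x n ((Finset.le_sup hx).trans hn)]
      exact zero_mem _
    | zero => simp
    | add x y _ _ hx hy =>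
      exact ⟨add_mem hx.1 hy.1, by rw [map_add]; exact add_mem hx.2 hy.2⟩
    | smul a x _ hx =>
      refine ⟨M₁.smul_mem _ hx.1, ?_⟩
      obtain ⟨c, hc⟩ := key a
      have e1 := h2 _ (hc x hx.1) n
      rw [map_sub, map_smul (gpr ℳ n) c x] at e1
      have e2 : c • gpr ℳ n x ∈ M₂ := by
        rw [← algebraMap_smul R c]
        exact M₂.smul_mem _ hx.2
      simpa using add_mem e1 e2
  exact aux.2

lemma qpoly_main [IsNoetherian R N] (hfd : ∀ i, FiniteDimensional ℂ (ℳ i))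
    (s : Finset R) (hs : Algebra.adjoin ℂ (s : Set R) = ⊤)
    (deg : R → ℕ) (hdeg : ∀ x ∈ s, x ∈ 𝒜 (deg x)) (m : ℕ) (hm : 1 ≤ m)
    (hdm : ∀ x ∈ s, deg x ∣ m) (u : Finset R) (hus : u ⊆ s) :
    ∀ M₁ M₂ : Submodule R N, HomogSub ℳ M₁ → HomogSub ℳ M₂ → M₂ ≤ M₁ →
      (∀ x ∈ s, x ∉ u → ∀ v ∈ M₁, x • v ∈ M₂) →
      QPoly m (fun n => (Module.finrank ℂ (piece ℳ M₁ n) : ℚ) -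
        (Module.finrank ℂ (piece ℳ M₂ n) : ℚ)) := by
  classical
  have hfp : ∀ (M : Submodule R N) n, FiniteDimensional ℂ (piece ℳ M n) := fun M n =>
    Submodule.finiteDimensional_of_le (inf_le_right : piece ℳ M n ≤ ℳ n)
  induction u using Finset.induction_on with
  | empty =>
    intro M₁ M₂ h1 h2 h12 hk
    obtain ⟨n₀, hn₀⟩ := qpoly_base ℳ (s : Set R) hs M₁ M₂ h2 (fun x hx => hk x hx (by simp))
    refine QPoly.of_eventually_zero hm n₀ fun n hn => ?_
    have : piece ℳ M₁ n = piece ℳ M₂ n := by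
      apply le_antisymm
      · rintro v ⟨hv, hvn⟩
        refine ⟨?_, hvn⟩
        have := hn₀ n hn v hv
        rwa [gpr_same ℳ hvn] at this
      · rintro v ⟨hv, hvn⟩
        exact ⟨h12 hv, hvn⟩
    rw [this, sub_self]
  | insert x u hxu ih =>
    intro M₁ M₂ h1 h2 h12 hk
    have hxs : x ∈ s := hus (Finset.mem_insert_self _ _)
    have hx := hdeg x hxs
    have ih' := ih (fun y hy => hus (Finset.mem_insert_of_mem hy))
    set K := M₁ ⊓ M₂.comap (mulBy x) with hK
    set I := M₂ ⊔ M₁.map (mulBy x) with hI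
    have hKM : M₂ ≤ K := fun v hv => ⟨h12 hv, M₂.smul_mem x hv⟩
    have hIM : I ≤ M₁ := by
      apply sup_le h12
      rintro _ ⟨w, hw, rfl⟩
      exact M₁.smul_mem x hw
    have qK := ih' K M₂ (homog_inf 𝒜 ℳ x hx M₁ M₂ h1 h2) h2 hKM (by
      intro y hy hyu v hv
      by_cases hyx : y = x
      · subst hyx; exact hv.2
      · exact hk y hy (by simp [hyx, hyu]) v hv.1)
    have qI := ih' M₁ I h1 (homog_sup 𝒜 ℳ x hx M₁ M₂ h1 h2) hIM (by
      intro y hy hyu v hv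
      by_cases hyx : y = x
      · subst hyx; exact Submodule.mem_sup_right ⟨v, hv, rfl⟩
      · exact Submodule.mem_sup_left (hk y hy (by simp [hyx, hyu]) v hv))
    refine QPoly.of_diff_dvd hm (hdm x hxs) ?_
    have := (qI.shift (deg x)).sub qK
    convert this using 2 with n
    have e := finrank_exact ((mulBy (N := N) x).restrictScalars ℂ) (piece ℳ M₁ n)
      (piece ℳ M₂ (n + deg x))
    rw [← piece_inf 𝒜 ℳ x hx, ← piece_sup 𝒜 ℳ x hx M₁ M₂ h1 h2, ← hK, ← hI] at e
    have e' : (Module.finrank ℂ (piece ℳ M₁ n) : ℚ) + Module.finrank ℂ (piece ℳ M₂ (n + deg x)) =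
      Module.finrank ℂ (piece ℳ K n) + Module.finrank ℂ (piece ℳ I (n + deg x)) := by
      exact_mod_cast e
    linarith

lemma qpoly_N [IsNoetherian R N] (hfd : ∀ i, FiniteDimensional ℂ (ℳ i))
    (s : Finset R) (hs : Algebra.adjoin ℂ (s : Set R) = ⊤)
    (deg : R → ℕ) (hdeg : ∀ x ∈ s, x ∈ 𝒜 (deg x)) (m : ℕ) (hm : 1 ≤ m)
    (hdm : ∀ x ∈ s, deg x ∣ m) :
    QPoly m (fun n => (Module.finrank ℂ (ℳ n) : ℚ)) := by
  have := qpoly_main 𝒜 ℳ hfd s hs deg hdeg m hm hdm s (fun _ h => h) ⊤ ⊥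
    (fun _ _ _ => trivial) (by
      intro v hv i
      rw [Submodule.mem_bot] at hv ⊢
      rw [hv, map_zero]) bot_le (fun x hx hx' => absurd hx hx')
  convert this using 2 with n
  have e1 : piece ℳ (⊤ : Submodule R N) n = ℳ n := by
    simp only [piece, Submodule.restrictScalars_top]
    exact top_inf_eq _
  have e2 : piece ℳ (⊥ : Submodule R N) n = ⊥ := by
    simp only [piece, Submodule.restrictScalars_bot]
    exact bot_inf_eq _
  rw [e1, e2]
  simp

end graded

lemma exists_gens {R : Type} [CommRing R] [Algebra ℂ R] (𝒜 : ℕ → Submodule ℂ R)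
    [GradedAlgebra 𝒜] (h0 : 𝒜 0 = Submodule.span ℂ {1}) [Algebra.FiniteType ℂ R] :
    ∃ (s : Finset R) (deg : R → ℕ), Algebra.adjoin ℂ (s : Set R) = ⊤ ∧
      ∀ x ∈ s, 1 ≤ deg x ∧ x ∈ 𝒜 (deg x) := by
  classical
  obtain ⟨F, hF⟩ := Algebra.FiniteType.out (R := ℂ) (A := R)
  choose k hk using exists_gpr_bound 𝒜
  let s : Finset R := F.biUnion fun f => (Finset.range (k f)).image fun i => gpr 𝒜 (i + 1) f
  have hs : ∀ x ∈ s, ∃ n, 1 ≤ n ∧ x ∈ 𝒜 n := by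
    intro x hx
    simp only [s, Finset.mem_biUnion, Finset.mem_image] at hx
    obtain ⟨f, _, i, _, rfl⟩ := hx
    exact ⟨i + 1, by omega, gpr_mem 𝒜 _ _⟩
  choose! deg hdeg using hs
  refine ⟨s, deg, ?_, hdeg⟩
  rw [← top_le_iff, ← hF, Algebra.adjoin_le_iff]
  intro f hf
  have e := sum_gpr 𝒜 f (k f + 1) (fun i hi => hk f i (by omega))
  rw [Finset.sum_range_succ'] at e
  rw [SetLike.mem_coe, ← e]
  refine add_mem (sum_mem fun i hi => Algebra.subset_adjoin ?_) ?_
  · simp only [s, Finset.coe_biUnion, Set.mem_iUnion, Finset.coe_image]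
    exact ⟨f, hf, i, hi, rfl⟩
  · have := gpr_mem 𝒜 0 f
    rw [h0, Submodule.mem_span_singleton] at this
    obtain ⟨c, hc⟩ := this
    rw [← hc]
    exact Subalgebra.smul_mem _ (one_mem _) c

lemma ringKrullDim_of_integral_inj {P A : Type} [CommRing P] [CommRing A] [IsDomain P] (g : P →+* A)
    (hinj : Function.Injective g) (hint : g.IsIntegral) : ringKrullDim A = ringKrullDim P := by
  letI := g.toAlgebra
  haveI : Algebra.IsIntegral P A := ⟨hint⟩
  apply le_antisymm
  · refine Order.krullDim_le_of_strictMono (PrimeSpectrum.comap (algebraMap P A)) ?_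
    intro I J hIJ
    exact Ideal.IsIntegral.comap_lt_comap (I := I.asIdeal) (J := J.asIdeal) hIJ
  · refine iSup_le fun l => ?_
    obtain ⟨Q, _, hQ, hQ'⟩ := Ideal.exists_ideal_over_prime_of_isIntegral (S := A)
      l.head.asIdeal ⊥ (by
        intro x hx
        have : g x = 0 := hx
        rw [map_eq_zero_iff g hinj] at this
        rw [this]; exact zero_mem _)
    haveI : Q.LiesOver l.head.asIdeal := ⟨hQ'.symm⟩
    obtain ⟨L, hL, _⟩ := Ideal.exists_ltSeries_of_hasGoingUp l Q
    rw [← hL]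
    exact le_iSup (fun p : LTSeries (PrimeSpectrum A) => (p.length : WithBot ℕ∞)) L

lemma noether_data (R : Type) [CommRing R] [Algebra ℂ R] [Algebra.FiniteType ℂ R]
    (N : Type) [AddCommGroup N] [Module ℂ N] [Module R N] [IsScalarTower ℂ R N]
    [Nontrivial N] [Module.Finite R N] :
    ∃ d : ℕ, (d : WithBot (WithTop ℕ)) = ringKrullDim (R ⧸ Module.annihilator R N) ∧
    ∃ (z : Fin d → R) (U : Finset N),
      (∀ v : N, v ∈ Submodule.span ℂ
        {w : N | ∃ (p : MvPolynomial (Fin d) ℂ), ∃ u ∈ U, w = MvPolynomial.aeval z p • u}) ∧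
      (∀ p : MvPolynomial (Fin d) ℂ, (∀ v : N, MvPolynomial.aeval z p • v = 0) → p = 0) := by
  classical
  haveI : Nontrivial (R ⧸ Module.annihilator R N) := by
    apply Ideal.Quotient.nontrivial_iff.2
    intro h
    have h1 : (1 : R) ∈ Module.annihilator R N := by rw [h]; trivial
    obtain ⟨v, hv⟩ := exists_ne (0 : N)
    apply hv
    simpa using Module.mem_annihilator.1 h1 v
  obtain ⟨d, g, hinj, hfin⟩ := exists_finite_inj_algHom_of_fg ℂ (R ⧸ Module.annihilator R N)
  refine ⟨d, ?_, ?_⟩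
  · rw [ringKrullDim_of_integral_inj g.toRingHom hinj hfin.to_isIntegral,
      MvPolynomial.ringKrullDim_of_isNoetherianRing]
    simp
    rfl
  have hsurj := Ideal.Quotient.mk_surjective (I := Module.annihilator R N)
  choose lift hlift using hsurj
  let z : Fin d → R := fun i => lift (g (MvPolynomial.X i))
  have hφ : ∀ p, Ideal.Quotient.mk (Module.annihilator R N) (MvPolynomial.aeval z p) = g p := by
    have : (Ideal.Quotient.mkₐ ℂ (Module.annihilator R N)).comp (MvPolynomial.aeval z) = g := by
      apply MvPolynomial.algHom_ext
      intro i
      simp [z, hlift]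
    intro p
    exact DFunLike.congr_fun this p
  have hsm : ∀ r r' : R, Ideal.Quotient.mk (Module.annihilator R N) r =
      Ideal.Quotient.mk (Module.annihilator R N) r' → ∀ v : N, r • v = r' • v := by
    intro r r' h v
    rw [Ideal.Quotient.eq, Module.mem_annihilator] at h
    have := h v
    rwa [sub_smul, sub_eq_zero] at this
  letI := g.toRingHom.toAlgebra
  have hfin' : Module.Finite (MvPolynomial (Fin d) ℂ) (R ⧸ Module.annihilator R N) := hfin
  obtain ⟨S, hS⟩ := hfin'.fg_top
  obtain ⟨W, hW⟩ := (Module.Finite.fg_top : (⊤ : Submodule R N).FG)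
  let U : Finset N := Finset.image₂ (fun a w => lift a • w) S W
  refine ⟨z, U, ?_, ?_⟩
  · set L := Submodule.span ℂ
        {w : N | ∃ (p : MvPolynomial (Fin d) ℂ), ∃ u ∈ U, w = MvPolynomial.aeval z p • u} with hL
    have hLp : ∀ p : MvPolynomial (Fin d) ℂ, ∀ v ∈ L, MvPolynomial.aeval z p • v ∈ L := by
      intro p v hv
      rw [hL] at hv
      induction hv using Submodule.span_induction with
      | mem x hx =>
        obtain ⟨q, u, hu, rfl⟩ := hx
        refine Submodule.subset_span ⟨p * q, u, hu, ?_⟩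
        rw [map_mul, mul_smul]
      | zero => rw [smul_zero]; exact zero_mem _
      | add x y _ _ hx hy => rw [smul_add]; exact add_mem hx hy
      | smul c x _ hx => rw [smul_comm]; exact L.smul_mem _ hx
    have key : ∀ a : R ⧸ Module.annihilator R N, ∀ w ∈ W, lift a • w ∈ L := by
      intro a w hw
      have ha : a ∈ Submodule.span (MvPolynomial (Fin d) ℂ) (S : Set (R ⧸ Module.annihilator R N)) := by
        rw [hS]; trivial
      induction ha using Submodule.span_induction with
      | mem x hx =>
        refine Submodule.subset_span ⟨1, lift x • w, Finset.mem_image₂_of_mem hx hw, ?_⟩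
        rw [map_one, one_smul]
      | zero =>
        rw [hsm (lift 0) 0 (by rw [hlift, map_zero]), zero_smul]
        exact zero_mem _
      | add x y _ _ hx hy =>
        rw [hsm (lift (x + y)) (lift x + lift y) (by rw [map_add, hlift, hlift, hlift]), add_smul]
        exact add_mem hx hy
      | smul p x _ hx =>
        rw [hsm (lift (p • x)) (MvPolynomial.aeval z p * lift x)
          (by rw [map_mul, hlift, hlift, hφ]; rfl), mul_smul]
        exact hLp _ _ hx
    intro v
    have hv : v ∈ Submodule.span R (W : Set N) := by rw [hW]; trivial
    rw [Submodule.mem_span_finset] at hv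
    obtain ⟨f, _, rfl⟩ := hv
    refine sum_mem fun w hw => ?_
    rw [hsm (f w) (lift (Ideal.Quotient.mk _ (f w))) (by rw [hlift])]
    exact key _ _ hw
  · intro p hp
    apply hinj
    rw [← hφ, map_zero, Ideal.Quotient.eq_zero_iff_mem, Module.mem_annihilator]
    exact hp

section bounds

set_option linter.unusedSectionVars false

variable {R : Type} [CommRing R] [Algebra ℂ R]
    {N : Type} [AddCommGroup N] [Module ℂ N] [Module R N] [IsScalarTower ℂ R N]
    {d : ℕ} (z : Fin d → R) (U : Finset N)

/-- span of the monomials with exponents at most `n`, applied to `U` -/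
def boxSpan (n : ℕ) : Submodule ℂ N :=
  Submodule.span ℂ (Set.range fun q : (Fin d → Fin (n + 1)) × U =>
    (∏ j, z j ^ (q.1 j : ℕ)) • (q.2 : N))

lemma boxSpan_fd (n : ℕ) : FiniteDimensional ℂ (boxSpan z U n) :=
  FiniteDimensional.span_of_finite ℂ (Set.finite_range _)

lemma boxSpan_finrank (n : ℕ) : Module.finrank ℂ (boxSpan z U n) ≤ U.card * (n + 1) ^ d := by
  have := finrank_range_le_card (R := ℂ) (fun q : (Fin d → Fin (n + 1)) × U =>
    (∏ j, z j ^ (q.1 j : ℕ)) • (q.2 : N))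
  refine this.trans (le_of_eq ?_)
  simp [mul_comm]

lemma mem_boxSpan (n : ℕ) (e : Fin d → ℕ) (he : ∀ j, e j ≤ n) (u : N) (hu : u ∈ U) :
    (∏ j, z j ^ (e j)) • u ∈ boxSpan z U n :=
  Submodule.subset_span ⟨(fun j => ⟨e j, by have := he j; omega⟩, ⟨u, hu⟩), rfl⟩

lemma boxSpan_mono {n n' : ℕ} (h : n ≤ n') : boxSpan z U n ≤ boxSpan z U n' := by
  apply Submodule.span_le.2
  rintro _ ⟨q, rfl⟩
  exact mem_boxSpan z U n' _ (fun j => by have := (q.1 j).2; omega) _ q.2.2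

lemma smul_mem_span_of (x : R) (s : Set N) (L : Submodule ℂ N) (h : ∀ v ∈ s, x • v ∈ L) (v : N)
    (hv : v ∈ Submodule.span ℂ s) : x • v ∈ L := by
  induction hv using Submodule.span_induction with
  | mem v hv => exact h v hv
  | zero => rw [smul_zero]; exact zero_mem _
  | add x y _ _ hx hy => rw [smul_add]; exact add_mem hx hy
  | smul c x _ hx => rw [smul_comm]; exact L.smul_mem _ hx

lemma boxSpan_smul {n k : ℕ} (e : Fin d → ℕ) (he : ∀ j, e j ≤ k) (v : N) (hv : v ∈ boxSpan z U n) :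
    (∏ j, z j ^ (e j)) • v ∈ boxSpan z U (n + k) := by
  refine smul_mem_span_of _ _ _ ?_ v hv
  rintro _ ⟨q, rfl⟩
  rw [← mul_smul, ← Finset.prod_mul_distrib]
  simp only [← pow_add]
  exact mem_boxSpan z U _ _ (fun j => by have := (q.1 j).2; have := he j; omega) _ q.2.2

lemma boxSpan_exhaust (hspan : ∀ v : N, v ∈ Submodule.span ℂ
        {w : N | ∃ (p : MvPolynomial (Fin d) ℂ), ∃ u ∈ U, w = MvPolynomial.aeval z p • u}) (v : N) :
    ∃ n, v ∈ boxSpan z U n := by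
  have hadd : ∀ x y : N, (∃ n, x ∈ boxSpan z U n) → (∃ n, y ∈ boxSpan z U n) →
      ∃ n, x + y ∈ boxSpan z U n := by
    rintro x y ⟨n, hn⟩ ⟨n', hn'⟩
    exact ⟨max n n', add_mem (boxSpan_mono z U (le_max_left _ _) hn)
      (boxSpan_mono z U (le_max_right _ _) hn')⟩
  induction hspan v using Submodule.span_induction with
  | mem x hx =>
    obtain ⟨p, u, hu, rfl⟩ := hx
    induction p using MvPolynomial.induction_on' with
    | monomial e a =>
      refine ⟨Finset.univ.sup e, ?_⟩
      rw [MvPolynomial.aeval_monomial, mul_smul, algebraMap_smul,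
        Finsupp.prod_fintype _ _ (fun i => pow_zero _)]
      exact Submodule.smul_mem _ _ (mem_boxSpan z U _ _
        (fun j => Finset.le_sup (f := e) (Finset.mem_univ j)) u hu)
    | add p q hp hq =>
      rw [map_add, add_smul]
      exact hadd _ _ hp hq
  | zero => exact ⟨0, zero_mem _⟩
  | add x y _ _ hx hy => exact hadd _ _ hx hy
  | smul c x _ hx =>
    obtain ⟨n, hn⟩ := hx
    exact ⟨n, Submodule.smul_mem _ _ hn⟩

variable (𝒜 : ℕ → Submodule ℂ R) (ℳ : ℕ → Submodule ℂ N) [DirectSum.Decomposition ℳ]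
  [SetLike.GradedSMul 𝒜 ℳ]

lemma piece_le_boxSpan [Module.Finite R N]
    (hspan : ∀ v : N, v ∈ Submodule.span ℂ
        {w : N | ∃ (p : MvPolynomial (Fin d) ℂ), ∃ u ∈ U, w = MvPolynomial.aeval z p • u})
    (s : Finset R) (hs : Algebra.adjoin ℂ (s : Set R) = ⊤)
    (deg : R → ℕ) (hdeg : ∀ x ∈ s, 1 ≤ deg x ∧ x ∈ 𝒜 (deg x)) :
    ∃ b c, ∀ n, ℳ n ≤ boxSpan z U (b * n + c) := by
  classical
  choose k hk using boxSpan_exhaust z U hspan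
  obtain ⟨W, hW⟩ := (Module.Finite.fg_top : (⊤ : Submodule R N).FG)
  let b := s.sup fun x => U.sup fun u => k (x • u)
  have hb : ∀ x ∈ s, ∀ n, ∀ v ∈ boxSpan z U n, x • v ∈ boxSpan z U (n + b) := by
    intro x hx n v hv
    refine smul_mem_span_of _ _ _ ?_ v hv
    rintro _ ⟨q, rfl⟩
    rw [smul_comm, add_comm n b]
    refine boxSpan_smul z U _ (fun j => by have := (q.1 j).2; omega) _ ?_
    refine boxSpan_mono z U ?_ (hk _)
    exact (Finset.le_sup (f := fun u => k (x • u)) q.2.2).trans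
      (Finset.le_sup (f := fun x => U.sup fun u => k (x • u)) hx)
  choose t ht using exists_gpr_bound ℳ
  let c := W.sup fun w => (Finset.range (t w)).sup fun i => k (gpr ℳ i w)
  refine ⟨b, c, ?_⟩
  have key : ∀ r : R, ∀ v : N, (∀ i, gpr ℳ i v ∈ boxSpan z U (b * i + c)) →
      ∀ i, gpr ℳ i (r • v) ∈ boxSpan z U (b * i + c) := by
    intro r
    have hr : r ∈ Algebra.adjoin ℂ (s : Set R) := by rw [hs]; trivial
    induction hr using Algebra.adjoin_induction with
    | mem x hx =>
      intro v hv i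
      obtain ⟨h1, h2⟩ := hdeg x hx
      by_cases hi : i < deg x
      · rw [gpr_smul_lt 𝒜 ℳ h2 i hi]
        exact zero_mem _
      · obtain ⟨j, rfl⟩ := Nat.exists_eq_add_of_le (not_lt.1 hi)
        rw [add_comm (deg x) j, gpr_smul 𝒜 ℳ h2]
        refine boxSpan_mono z U ?_ (hb x hx _ _ (hv j))
        nlinarith
    | algebraMap a =>
      intro v hv i
      rw [algebraMap_smul, map_smul]
      exact Submodule.smul_mem _ _ (hv i)
    | add x y _ _ hx hy =>
      intro v hv i
      rw [add_smul, map_add]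
      exact add_mem (hx v hv i) (hy v hv i)
    | mul x y _ _ hx hy =>
      intro v hv i
      rw [mul_smul]
      exact hx _ (hy v hv) i
  have all : ∀ v : N, ∀ i, gpr ℳ i v ∈ boxSpan z U (b * i + c) := by
    intro v
    have hv : v ∈ Submodule.span R (W : Set N) := by rw [hW]; trivial
    induction hv using Submodule.span_induction with
    | mem w hw =>
      intro i
      by_cases hi : i < t w
      · refine boxSpan_mono z U ?_ (hk _)
        have h1 := Finset.le_sup (f := fun i => k (gpr ℳ i w)) (Finset.mem_range.2 hi)
        have h2 := Finset.le_sup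
          (f := fun w => (Finset.range (t w)).sup fun i => k (gpr ℳ i w)) hw
        exact (h1.trans h2).trans (Nat.le_add_left _ _)
      · rw [ht w i (by omega)]
        exact zero_mem _
    | zero => intro i; rw [map_zero]; exact zero_mem _
    | add x y _ _ hx hy => intro i; rw [map_add]; exact add_mem (hx i) (hy i)
    | smul a x _ hx => exact key a x hx
  intro n v hv
  have := all v n
  rwa [gpr_same ℳ hv] at this

lemma upper_bound (hfd : ∀ i, FiniteDimensional ℂ (ℳ i)) (b c : ℕ)
    (h : ∀ n, ℳ n ≤ boxSpan z U (b * n + c)) (n : ℕ) :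
    ∑ i ∈ Finset.range (n + 1), Module.finrank ℂ (ℳ i) ≤ U.card * (b * n + c + 1) ^ d := by
  refine le_trans ?_ (boxSpan_finrank z U (b * n + c))
  rw [Finset.sum_range, ← Module.finrank_pi_fintype ℂ]
  haveI := boxSpan_fd z U (b * n + c)
  let S : ((i : Fin (n + 1)) → ℳ i) →ₗ[ℂ] N := ∑ i : Fin (n + 1), (ℳ i).subtype ∘ₗ (LinearMap.proj i : ((i : Fin (n + 1)) → ℳ i) →ₗ[ℂ] ℳ i)
  have hS : ∀ v, S v = ∑ i, (v i : N) := by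
    intro v
    simp [S]
  refine LinearMap.finrank_le_finrank_of_injective
    (f := S.codRestrict (boxSpan z U (b * n + c)) ?_) ?_
  · intro v
    rw [hS]
    refine sum_mem fun i _ => boxSpan_mono z U ?_ (h i (v i).2)
    have : (i : ℕ) ≤ n := by have := i.2; omega
    gcongr
  · rw [← LinearMap.ker_eq_bot, LinearMap.ker_codRestrict, LinearMap.ker_eq_bot']
    intro v hv
    rw [hS] at hv
    funext j
    have := congrArg (gpr ℳ j) hv
    rw [map_sum, map_zero, Finset.sum_eq_single j, gpr_same ℳ (v j).2] at this
    · exact Subtype.ext this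
    · intro i _ hij
      exact gpr_ne ℳ (v i).2 (fun h => hij (Fin.ext h))
    · intro h; exact absurd (Finset.mem_univ _) h

/-- `x` raises degrees by at most `c` -/
def RaisesBy (x : R) (c : ℕ) : Prop :=
  ∀ (v : N) (k : ℕ), (∀ i, k ≤ i → gpr ℳ i v = 0) → ∀ i, k + c ≤ i → gpr ℳ i (x • v) = 0

lemma RaisesBy.one : RaisesBy ℳ (1 : R) 0 := by
  intro v k hv i hi
  rw [one_smul]
  exact hv i hi

lemma RaisesBy.mul {x y : R} {a b : ℕ} (hx : RaisesBy ℳ x a) (hy : RaisesBy ℳ y b) :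
    RaisesBy ℳ (x * y) (a + b) := by
  intro v k hv i hi
  rw [mul_smul]
  exact hx _ _ (hy v k hv) i (by omega)

lemma RaisesBy.le {x : R} {a b : ℕ} (hx : RaisesBy ℳ x a) (hab : a ≤ b) :
    RaisesBy ℳ x b := fun v k hv i hi => hx v k hv i (by omega)

lemma RaisesBy.pow {x : R} {a : ℕ} (hx : RaisesBy ℳ x a) (e : ℕ) : RaisesBy ℳ (x ^ e) (e * a) := by
  induction e with
  | zero => simpa using RaisesBy.one (R := R) ℳ
  | succ e ih =>
    rw [pow_succ, add_mul, one_mul]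
    exact ih.mul ℳ hx

lemma RaisesBy.prod {ι : Type} (t : Finset ι) (x : ι → R) (a : ℕ) (hx : ∀ i, RaisesBy ℳ (x i) a) :
    RaisesBy ℳ (∏ i ∈ t, x i) (t.card * a) := by
  classical
  induction t using Finset.induction_on with
  | empty => simpa using RaisesBy.one (R := R) ℳ
  | insert i t hi ih =>
    rw [Finset.prod_insert hi, Finset.card_insert_of_notMem hi, add_mul, one_mul, add_comm]
    exact (hx i).mul ℳ ih

lemma exists_raisesBy [DirectSum.Decomposition 𝒜] (x : R) : ∃ c, RaisesBy ℳ x c := by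
  obtain ⟨c, hc⟩ := exists_gpr_bound 𝒜 x
  refine ⟨c, fun v k hv i hi => ?_⟩
  rw [← sum_gpr 𝒜 x c hc, Finset.sum_smul, map_sum]
  refine Finset.sum_eq_zero fun j hj => ?_
  have hj := Finset.mem_range.1 hj
  obtain ⟨l, rfl⟩ := Nat.exists_eq_add_of_le (show j ≤ i by omega)
  rw [add_comm, gpr_smul 𝒜 ℳ (gpr_mem 𝒜 j x), hv l (by omega), smul_zero]

lemma lower_bound [DirectSum.Decomposition 𝒜] (hfd : ∀ i, FiniteDimensional ℂ (ℳ i))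
    (hspan : ∀ v : N, v ∈ Submodule.span ℂ
        {w : N | ∃ (p : MvPolynomial (Fin d) ℂ), ∃ u ∈ U, w = MvPolynomial.aeval z p • u})
    (hfaith : ∀ p : MvPolynomial (Fin d) ℂ, (∀ v : N, MvPolynomial.aeval z p • v = 0) → p = 0) :
    ∃ c c', ∀ n, (n + 1) ^ d ≤
      U.card * ∑ i ∈ Finset.range (c * n + c' + 1), Module.finrank ℂ (ℳ i) := by
  classical
  choose t ht using exists_gpr_bound ℳ
  choose a ha using exists_raisesBy 𝒜 ℳ
  let A := Finset.univ.sup fun j => a (z j)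
  have hA : ∀ j, RaisesBy ℳ (z j) A := fun j =>
    (ha (z j)).le ℳ (Finset.le_sup (f := fun j => a (z j)) (Finset.mem_univ j))
  let c' := U.sup t
  refine ⟨d * A, c', fun n => ?_⟩
  set K := d * A * n + c' with hK
  have hmon : ∀ f : Fin d → Fin (n + 1), ∀ u ∈ U, ∀ i, K + 1 ≤ i →
      gpr ℳ i ((∏ j, z j ^ (f j : ℕ)) • u) = 0 := by
    intro f u hu i hi
    have h1 := RaisesBy.prod ℳ Finset.univ (fun j => z j ^ (f j : ℕ)) (n * A) (fun j =>
      ((hA j).pow ℳ (f j)).le ℳ (by have := (f j).2; gcongr; omega))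
    refine h1 u (t u) (ht u) i ?_
    have h2 : t u ≤ c' := Finset.le_sup (f := t) hu
    rw [Finset.card_univ, Fintype.card_fin]
    have : d * (n * A) = d * A * n := by ring
    omega
  let Ψ : ((Fin d → Fin (n + 1)) → ℂ) →ₗ[ℂ] (U → (i : Fin (K + 1)) → ℳ i) :=
    LinearMap.pi fun u => LinearMap.pi fun i =>
      (DirectSum.component ℂ ℕ (fun i => ℳ i) i ∘ₗ
        (DirectSum.decomposeLinearEquiv ℳ).toLinearMap) ∘ₗ
        Fintype.linearCombination ℂ (fun f : Fin d → Fin (n + 1) =>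
          (∏ j, z j ^ (f j : ℕ)) • (u : N))
  have hinj : Function.Injective Ψ := by
    rw [← LinearMap.ker_eq_bot, LinearMap.ker_eq_bot']
    intro x hx
    let ex : (Fin d → Fin (n + 1)) → (Fin d →₀ ℕ) := fun f =>
      Finsupp.equivFunOnFinite.symm fun j => (f j : ℕ)
    have hex : Function.Injective ex := by
      intro f f' h
      have := Finsupp.equivFunOnFinite.symm.injective h
      funext j
      exact Fin.ext (congrFun this j)
    let p : MvPolynomial (Fin d) ℂ := ∑ f, x f • MvPolynomial.monomial (ex f) 1
    have hp : ∀ u : N, MvPolynomial.aeval z p • u =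
        ∑ f, x f • (∏ j, z j ^ (f j : ℕ)) • u := by
      intro u
      simp only [p, map_sum, Finset.sum_smul, map_smul, smul_assoc]
      refine Finset.sum_congr rfl fun f _ => ?_
      rw [MvPolynomial.aeval_monomial, map_one, one_mul,
        Finsupp.prod_fintype _ _ (fun i => pow_zero _)]
      rfl
    have hpU : ∀ u ∈ U, MvPolynomial.aeval z p • u = 0 := by
      intro u hu
      apply eq_zero_of_gpr ℳ
      intro i
      rw [hp]
      by_cases hi : i < K + 1
      · have := congrArg Subtype.val (congrFun (congrFun hx ⟨u, hu⟩) ⟨i, hi⟩)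
        simp only [Ψ, LinearMap.pi_apply, LinearMap.comp_apply,
          Fintype.linearCombination_apply] at this
        exact this
      · rw [map_sum]
        refine Finset.sum_eq_zero fun f _ => ?_
        rw [map_smul, hmon f u hu i (by omega), smul_zero]
    have hp0 : p = 0 := by
      apply hfaith
      intro v
      have := smul_mem_span_of (MvPolynomial.aeval z p) _ ⊥ (by
        rintro _ ⟨q, u, hu, rfl⟩
        rw [smul_comm, hpU u hu, smul_zero]
        exact zero_mem _) v (hspan v)
      simpa using this
    have hli : LinearIndependent ℂ (fun f => MvPolynomial.monomial (ex f) (1 : ℂ)) := by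
      have := (MvPolynomial.basisMonomials (Fin d) ℂ).linearIndependent.comp ex hex
      simpa [Function.comp_def] using this
    funext f
    exact Fintype.linearIndependent_iff.1 hli x hp0 f
  have := LinearMap.finrank_le_finrank_of_injective hinj
  rw [Module.finrank_pi_fintype ℂ] at this
  simp only [Module.finrank_pi_fintype ℂ] at this
  rw [Finset.sum_range]
  simpa using this

end bounds

/-- Let `R` be a commutative `ℕ`-graded `ℂ`-algebra, finitely generated
as a `ℂ`-algebra with `R₀ = ℂ`, and let `N ≠ 0` be a finitely generated `ℕ`-graded
`R`-module.  Then each graded piece `Nₙ` is a finite-dimensional `ℂ`-vector space, and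
there are an integer `m ≥ 1`, a natural number `d` equal to the Krull dimension of
`R/Ann_R(N)`, a positive integer `e` and polynomials `P₀, …, P_{m-1} ∈ ℚ[t]`, each with
leading term `(e/d!)·t^d`, such that `Σ_{i ≤ nm+r} dim_ℂ Nᵢ = P_r(n)` for all `r < m`
and all sufficiently large `n`. -/
theorem stmt_9 (R : Type) [CommRing R] [Algebra ℂ R] (𝒜 : ℕ → Submodule ℂ R)
    [GradedAlgebra 𝒜] (h0 : 𝒜 0 = Submodule.span ℂ {1}) [Algebra.FiniteType ℂ R]
    (N : Type) [AddCommGroup N] [Module ℂ N] [Module R N] [IsScalarTower ℂ R N]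
    (ℳ : ℕ → Submodule ℂ N) [DirectSum.Decomposition ℳ] [SetLike.GradedSMul 𝒜 ℳ]
    [Nontrivial N] [Module.Finite R N] :
    (∀ i : ℕ, FiniteDimensional ℂ (ℳ i)) ∧
    ∃ (m : ℕ), 1 ≤ m ∧
    ∃ (d : ℕ), (d : WithBot (WithTop ℕ)) = ringKrullDim (R ⧸ Module.annihilator R N) ∧
    ∃ (e : ℕ), 0 < e ∧
    ∃ P : Fin m → Polynomial ℚ,
      (∀ r : Fin m, (P r).degree ≤ d ∧ (P r).coeff d = (e : ℚ) / (Nat.factorial d : ℚ)) ∧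
      (∀ r : Fin m, ∃ n₀ : ℕ, ∀ n : ℕ, n₀ ≤ n →
        (P r).eval (n : ℚ) =
          ∑ i ∈ Finset.range (n * m + (r : ℕ) + 1), (Module.finrank ℂ (ℳ i) : ℚ)) := by
  classical
  obtain ⟨s, deg, hs, hdeg⟩ := exists_gens 𝒜 h0
  obtain ⟨d, hd, z, U, hspan, hfaith⟩ := noether_data R N
  obtain ⟨b, c, hbc⟩ := piece_le_boxSpan z U 𝒜 ℳ hspan s hs deg hdeg
  have hfd : ∀ i, FiniteDimensional ℂ (ℳ i) := fun i =>
    haveI := boxSpan_fd z U (b * i + c)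
    Submodule.finiteDimensional_of_le (hbc i)
  refine ⟨hfd, ?_⟩
  haveI : IsNoetherianRing R := Algebra.FiniteType.isNoetherianRing ℂ R
  haveI : IsNoetherian R N := inferInstance
  have hm : 1 ≤ ∏ x ∈ s, deg x :=
    Nat.one_le_iff_ne_zero.2 (Finset.prod_ne_zero_iff.2 fun x hx => by
      have := (hdeg x hx).1
      omega)
  have hq := (qpoly_N 𝒜 ℳ hfd s hs deg (fun x hx => (hdeg x hx).2) (∏ x ∈ s, deg x) hm
    (fun x hx => Finset.dvd_prod_of_mem deg hx)).partialSum hm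
  refine ⟨∏ x ∈ s, deg x, hm, d, hd, ?_⟩
  obtain ⟨e, he, P, hP, hP'⟩ := final_numeric
    (fun n => ∑ i ∈ Finset.range (n + 1), Module.finrank ℂ (ℳ i))
    (fun n n' h => Finset.sum_le_sum_of_subset (Finset.range_mono (by omega)))
    (∏ x ∈ s, deg x) hm d (by push_cast; exact hq)
    ⟨U.card, b, c, upper_bound z U ℳ hfd b c hbc⟩
    (by
      obtain ⟨c, c', h⟩ := lower_bound z U 𝒜 ℳ hfd hspan hfaith
      exact ⟨U.card, c, c', h⟩)
  refine ⟨e, he, P, hP, fun r => ?_⟩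
  obtain ⟨n₀, h⟩ := hP' r
  refine ⟨n₀, fun n hn => ?_⟩
  rw [h n hn]
  push_cast
  rfl
end
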